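/- arXiv:1708.02370 — 9 statements merged into one kernel-verified Lean document; each statement's English description precedes it below -/
import Mathlib

section
/- For every integer k ≥ 2 and every integer c ≥ 1, there exists a graph G such that C(k,3) is not a minor of G and G has no (2k−3)-colouring with clustering c. (Hence the clustered chromatic number of the class of C(k,3)-minor-free graphs is at least 2k−2.) -/
/-- `G` is `k`-colourable with clustering `c`: the vertices can be coloured with `k`
colours so that every monochromatic component has at most `c` vertices. -/
def ClusteredColourable {V : Type*} (G : SimpleGraph V) (k c : ℕ) : Prop :=
  ∃ f : V → Fin k, ∀ v : V,
    ((G.induce {u | f u = f v}).connectedComponentMk ⟨v, rfl⟩).supp.ncard ≤ c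

/-- `H` is a minor of `G`: there are pairwise disjoint connected branch sets in `G`,
one for each vertex of `H`, with an edge of `G` between the branch sets of any two
vertices adjacent in `H`. -/
def IsMinor {α : Type*} {β : Type*} (H : SimpleGraph α) (G : SimpleGraph β) : Prop :=
  ∃ X : α → Set β,
    (∀ a, (G.induce (X a)).Connected) ∧
    (Pairwise fun a b => Disjoint (X a) (X b)) ∧
    (∀ a b, H.Adj a b → ∃ x ∈ X a, ∃ y ∈ X b, G.Adj x y)

/-- A copy of `H` is a subgraph of `G`. -/
def IsSubgraphEmb {α : Type*} {β : Type*} (H : SimpleGraph α) (G : SimpleGraph β) : Prop :=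
  ∃ f : α → β, Function.Injective f ∧ ∀ a b, H.Adj a b → G.Adj (f a) (f b)

/-- `closureTree h k` is the closure `C(h,k)` of the complete `k`-ary tree of depth `h`:
vertices are the nodes of the tree (sequences over `Fin k` of length `< h`), and two
distinct nodes are adjacent iff one is an ancestor (i.e. a prefix) of the other. -/
def closureTree (h k : ℕ) : SimpleGraph {l : List (Fin k) // l.length < h} :=
  SimpleGraph.fromRel (fun u v => u.1 <+: v.1)

/-- `weakClosureTree h k` is the weak closure `W(h,k)` of the complete `k`-ary tree of
depth `h`: two nodes are adjacent iff one is a leaf (a node of depth `h`, i.e. a sequence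
of length `h - 1`) and the other is a proper ancestor (prefix) of it. -/
def weakClosureTree (h k : ℕ) : SimpleGraph {l : List (Fin k) // l.length < h} :=
  SimpleGraph.fromRel (fun u v => v.1.length = h - 1 ∧ u.1 <+: v.1)

/-- The connected tree-depth of a finite graph `H`: the least depth of a rooted tree
whose closure contains `H` as a subgraph.  (It suffices to consider complete `n`-ary
trees where `n` is the number of vertices of `H`.) -/
noncomputable def ctd {V : Type*} [Finite V] (H : SimpleGraph V) : ℕ :=
  sInf {h : ℕ | IsSubgraphEmb H (closureTree h (Nat.card V))}

/-- The tree-depth of a finite graph `H`: the maximum over the connected components of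
`H` of the connected tree-depth of that component. -/
noncomputable def treeDepth {V : Type*} [Finite V] (H : SimpleGraph V) : ℕ :=
  sSup {n : ℕ | ∃ C : H.ConnectedComponent, n = ctd (H.induce C.supp)}

/-- The `n`-fan: a path on `n` vertices plus one dominant vertex. -/
def fan (n : ℕ) : SimpleGraph (Option (Fin n)) :=
  SimpleGraph.fromRel (fun u v =>
    match u, v with
    | none, some _ => True
    | some i, some j => (i : ℕ) + 1 = (j : ℕ)
    | _, _ => False)

/-- The `n`-fat star: a star with centre `Sum.inl ()` and `n` leaves, where for each
edge from the centre to leaf `i` there are `n` extra vertices `(i, j)` adjacent to both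
the centre and leaf `i`. -/
def fatStar (n : ℕ) : SimpleGraph (Unit ⊕ Fin n ⊕ Fin n × Fin n) :=
  SimpleGraph.fromRel (fun u v =>
    match u, v with
    | Sum.inl _, Sum.inr _ => True
    | Sum.inr (Sum.inl i), Sum.inr (Sum.inr (i', _)) => i = i'
    | _, _ => False)

/-- The `n`-fat path: a path on `n` vertices, where for each edge `{e, e+1}` of the path
there are `n` extra vertices `(e, j)` adjacent to both endpoints of that edge. -/
def fatPath (n : ℕ) : SimpleGraph (Fin n ⊕ Fin (n - 1) × Fin n) :=
  SimpleGraph.fromRel (fun u v =>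
    match u, v with
    | Sum.inl i, Sum.inl j => (i : ℕ) + 1 = (j : ℕ)
    | Sum.inl i, Sum.inr (e, _) => (i : ℕ) = (e : ℕ) ∨ (i : ℕ) = (e : ℕ) + 1
    | _, _ => False)

/-- `G` has treewidth at most `w`: there is a tree decomposition of `G` all of whose
bags have at most `w + 1` vertices. -/
def HasTreewidthAtMost {V : Type*} (G : SimpleGraph V) (w : ℕ) : Prop :=
  ∃ (ι : Type) (T : SimpleGraph ι) (B : ι → Set V),
    T.Connected ∧ T.IsAcyclic ∧
    (∀ v : V, ∃ t, v ∈ B t) ∧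
    (∀ u v : V, G.Adj u v → ∃ t, u ∈ B t ∧ v ∈ B t) ∧
    (∀ v : V, (T.induce {t | v ∈ B t}).Connected) ∧
    (∀ t, (B t).ncard ≤ w + 1)

/-- A `k`-strong `H`-model in `G`: pairwise disjoint connected subgraphs `X a` of `G`,
one for each vertex `a` of `H`, such that for every edge `ab` of `H` at least `k`
vertices of `G` outside all the `X`'s have neighbours in both `X a` and `X b`. -/
def StrongModel {α : Type*} {β : Type*} (k : ℕ) (H : SimpleGraph α) (G : SimpleGraph β) : Prop :=
  ∃ X : α → Set β,
    (∀ a, (G.induce (X a)).Connected) ∧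
    (Pairwise fun a b => Disjoint (X a) (X b)) ∧
    (∀ a b, H.Adj a b →
      k ≤ {v : β | (∀ x, v ∉ X x) ∧ (∃ x ∈ X a, G.Adj v x) ∧ (∃ y ∈ X b, G.Adj v y)}.ncard)

namespace SimpleGraph

variable {V W α : Type*} {G : SimpleGraph V} {G' : SimpleGraph W}

/-- A function that is constant along the edges inside a connected set is constant on that set. -/
lemma eq_of_induce_connected {S : Set V} (hS : (G.induce S).Connected) (g : V → α)
    (hg : ∀ u ∈ S, ∀ v ∈ S, G.Adj u v → g u = g v) {u v : V} (hu : u ∈ S) (hv : v ∈ S) :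
    g u = g v := by
  obtain ⟨w⟩ := hS.preconnected ⟨u, hu⟩ ⟨v, hv⟩
  have key : ∀ (a b : S), (G.induce S).Walk a b → g a = g b := by
    intro a b w
    induction w with
    | nil => rfl
    | cons h _ ih => exact (hg _ (Subtype.prop _) _ (Subtype.prop _) h).trans ih
  exact key _ _ w

lemma induce_image_connected (φ : G →g G') {S : Set V} (hS : (G.induce S).Connected) :
    (G'.induce (φ '' S)).Connected := by
  refine hS.map (induceHom φ (Set.mapsTo_image φ S)) ?_
  rintro ⟨_, x, hx, rfl⟩
  exact ⟨⟨x, hx⟩, rfl⟩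

lemma induce_preimage_connected (φ : G ↪g G') {S : Set W} (hS : (G'.induce S).Connected)
    (hφ : S ⊆ Set.range φ) : (G.induce (φ ⁻¹' S)).Connected := by
  have hbij : Function.Bijective (fun x : φ ⁻¹' S => (⟨φ x, x.2⟩ : S)) := by
    constructor
    · intro x y hxy
      exact Subtype.ext (φ.injective (congrArg Subtype.val hxy))
    · rintro ⟨w, hw⟩
      obtain ⟨x, rfl⟩ := hφ hw
      exact ⟨⟨x, hw⟩, rfl⟩
  let e : G.induce (φ ⁻¹' S) ≃g G'.induce S :=
    { Equiv.ofBijective _ hbij with map_rel_iff' := φ.map_adj_iff }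
  exact e.connected_iff.mpr hS

lemma induce_insert_connected {v : V} {T : Set V} (hT : ∀ x ∈ T, G.Adj v x) :
    (G.induce (insert v T)).Connected := by
  refine induce_connected_of_patches v (Set.mem_insert v T) fun {x} hx => ?_
  rcases hx with rfl | hx
  · exact ⟨{x}, by simp, rfl, rfl, Reachable.refl _⟩
  · refine ⟨{v, x}, ?_, by simp, by simp, ?_⟩
    · rintro y (rfl | rfl)
      · exact Set.mem_insert _ _
      · exact Set.mem_insert_of_mem _ hx
    · exact (induce_pair_connected_of_adj (hT x hx)).preconnected _ _

/-- Every monochromatic connected set of the colouring `f` has at most `c` vertices. -/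
def HasClustering (G : SimpleGraph V) (f : V → α) (c : ℕ) : Prop :=
  ∀ S : Set V, (G.induce S).Connected → (∀ u ∈ S, ∀ v ∈ S, f u = f v) → S.ncard ≤ c

lemma HasClustering.comp_embedding {f : W → α} {c : ℕ} (hf : HasClustering G' f c)
    (φ : G ↪g G') : HasClustering G (f ∘ φ) c := by
  intro S hS hmono
  rw [← Set.ncard_image_of_injective S φ.injective]
  refine hf _ (induce_image_connected φ.toHom hS) ?_
  rintro _ ⟨u, hu, rfl⟩ _ ⟨v, hv, rfl⟩
  exact hmono u hu v hv

/-- The neighbours of `v` that share its colour are fewer than the clustering. -/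
lemma HasClustering.ncard_lt_of_adj [Finite V] {f : V → α} {c : ℕ} (hf : HasClustering G f c)
    {v : V} {T : Set V} (hT : ∀ x ∈ T, G.Adj v x) (hmono : ∀ x ∈ T, f x = f v) :
    T.ncard < c := by
  have hv : v ∉ T := fun h => (hT v h).ne rfl
  have := hf _ (induce_insert_connected hT) (by
    have h : ∀ x ∈ insert v T, f x = f v := by
      rintro x (rfl | hx)
      · rfl
      · exact hmono x hx
    exact fun x hx y hy => (h x hx).trans (h y hy).symm)
  rwa [Set.ncard_insert_of_notMem hv] at this

/-- The path on `n` vertices together with, for each edge of the path, `m` disjoint copies of `G`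
that are complete to both ends of the edge. The copies with first index `e` belong to the edge
from `e` to `e + 1`; for the last vertex of the path there is only one end. -/
def pathBlowup (G : SimpleGraph V) (n m : ℕ) : SimpleGraph (Fin n ⊕ Fin n × Fin m × V) :=
  SimpleGraph.fromRel fun u v =>
    match u, v with
    | Sum.inl i, Sum.inl j => (i : ℕ) + 1 = j
    | Sum.inl i, Sum.inr (e, _, _) => (i : ℕ) = e ∨ (i : ℕ) = e + 1
    | Sum.inr (e, j, x), Sum.inr (e', j', y) => e = e' ∧ j = j' ∧ G.Adj x y
    | _, _ => False

section pathBlowup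

variable {n m : ℕ}

lemma pathBlowup_adj_inl_inl {i j : Fin n} :
    (G.pathBlowup n m).Adj (Sum.inl i) (Sum.inl j) ↔ (i : ℕ) + 1 = j ∨ (j : ℕ) + 1 = i := by
  simp only [pathBlowup, fromRel_adj, ne_eq, Sum.inl.injEq, Fin.ext_iff]
  omega

lemma pathBlowup_adj_inl_inr {i e : Fin n} {j : Fin m} {x : V} :
    (G.pathBlowup n m).Adj (Sum.inl i) (Sum.inr (e, j, x)) ↔ (i : ℕ) = e ∨ (i : ℕ) = e + 1 := by
  simp [pathBlowup]

lemma pathBlowup_adj_inr_inr {e e' : Fin n} {j j' : Fin m} {x y : V} :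
    (G.pathBlowup n m).Adj (Sum.inr (e, j, x)) (Sum.inr (e', j', y)) ↔
      e = e' ∧ j = j' ∧ G.Adj x y := by
  simp only [pathBlowup, fromRel_adj, ne_eq, Sum.inr.injEq, Prod.mk.injEq]
  constructor
  · rintro ⟨-, h | ⟨rfl, rfl, h⟩⟩
    · exact h
    · exact ⟨rfl, rfl, h.symm⟩
  · rintro ⟨rfl, rfl, h⟩
    exact ⟨fun h' => h.ne h'.2.2, Or.inl ⟨rfl, rfl, h⟩⟩

/-- The inclusion of one of the copies of `G`. -/
def pathBlowupCopy (G : SimpleGraph V) (e : Fin n) (j : Fin m) : G ↪g G.pathBlowup n m where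
  toFun x := Sum.inr (e, j, x)
  inj' x y h := by simpa using h
  map_rel_iff' := pathBlowup_adj_inr_inr.trans (by simp)

/-- The position of a vertex along the path: even for path vertices, odd for the copies. -/
def pathBlowupPos : Fin n ⊕ Fin n × Fin m × V → ℕ
  | Sum.inl i => 2 * i
  | Sum.inr (e, _, _) => 2 * e + 1

/-- The copy of `G` that contains a vertex, if any. -/
def pathBlowupIndex : Fin n ⊕ Fin n × Fin m × V → Option (Fin n × Fin m)
  | Sum.inl _ => none
  | Sum.inr (e, j, _) => some (e, j)

/-- Each path vertex separates the vertices before it from those after it. -/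
lemma pathBlowup_adj_pos_lt {p : Fin n} {u v : Fin n ⊕ Fin n × Fin m × V}
    (hu : u ≠ Sum.inl p) (hv : v ≠ Sum.inl p) (h : (G.pathBlowup n m).Adj u v) :
    pathBlowupPos u < 2 * p ↔ pathBlowupPos v < 2 * p := by
  rcases u with i | ⟨e, j, x⟩ <;> rcases v with i' | ⟨e', j', x'⟩
  · rw [pathBlowup_adj_inl_inl] at h
    simp only [ne_eq, Sum.inl.injEq, Fin.ext_iff] at hu hv
    simp only [pathBlowupPos]
    omega
  · rw [pathBlowup_adj_inl_inr] at h
    simp only [ne_eq, Sum.inl.injEq, Fin.ext_iff] at hu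
    simp only [pathBlowupPos]
    omega
  · rw [adj_comm, pathBlowup_adj_inl_inr] at h
    simp only [ne_eq, Sum.inl.injEq, Fin.ext_iff] at hv
    simp only [pathBlowupPos]
    omega
  · rw [pathBlowup_adj_inr_inr] at h
    simp [pathBlowupPos, h.1]

lemma pathBlowup_adj_index {u v : Fin n ⊕ Fin n × Fin m × V}
    (hu : ∀ p, u ≠ Sum.inl p) (hv : ∀ p, v ≠ Sum.inl p) (h : (G.pathBlowup n m).Adj u v) :
    pathBlowupIndex u = pathBlowupIndex v := by
  rcases u with i | ⟨e, j, x⟩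
  · exact absurd rfl (hu i)
  rcases v with i' | ⟨e', j', x'⟩
  · exact absurd rfl (hv i')
  rw [pathBlowup_adj_inr_inr] at h
  simp [pathBlowupIndex, h.1, h.2.1]

/-- Some two consecutive path vertices get different colours when the path is longer than the
clustering. -/
lemma exists_pathBlowup_consecutive_ne {c : ℕ} {f : Fin (c + 1) ⊕ Fin (c + 1) × Fin m × V → α}
    (hf : HasClustering (G.pathBlowup (c + 1) m) f c) :
    ∃ i j : Fin (c + 1), (i : ℕ) + 1 = j ∧ f (Sum.inl i) ≠ f (Sum.inl j) := by
  by_contra! hcon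
  let φ : pathGraph (c + 1) →g G.pathBlowup (c + 1) m :=
    ⟨Sum.inl, fun h => pathBlowup_adj_inl_inl.mpr (pathGraph_adj.mp h)⟩
  have huniv : ((pathGraph (c + 1)).induce Set.univ).Connected :=
    (induceUnivIso _).connected_iff.mpr (pathGraph_connected c)
  have hconst : ∀ i j : Fin (c + 1), f (Sum.inl i) = f (Sum.inl j) := fun i j =>
    eq_of_induce_connected huniv (fun i => f (Sum.inl i))
      (fun i _ j _ h => by
        rcases pathGraph_adj.mp h with h | h
        · exact hcon i j h
        · exact (hcon j i h).symm) (Set.mem_univ i) (Set.mem_univ j)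
  have hcard := hf _ (induce_image_connected φ huniv) (by
    rintro _ ⟨i, -, rfl⟩ _ ⟨j, -, rfl⟩
    exact hconst i j)
  rw [Set.ncard_image_of_injective _ (show Function.Injective φ from Sum.inl_injective),
    Set.ncard_univ, Nat.card_fin] at hcard
  omega

/-- Few of the copies attached to a path vertex contain the colour of that vertex. -/
lemma ncard_pathBlowup_copies_lt [Finite V] {c : ℕ} {f : Fin n ⊕ Fin n × Fin m × V → α}
    (hf : HasClustering (G.pathBlowup n m) f c) {i e : Fin n}
    (hie : (i : ℕ) = e ∨ (i : ℕ) = e + 1) :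
    {j : Fin m | ∃ x, f (Sum.inr (e, j, x)) = f (Sum.inl i)}.ncard < c := by
  set T : Set (Fin n ⊕ Fin n × Fin m × V) :=
    {w | ∃ j x, w = Sum.inr (e, j, x) ∧ f w = f (Sum.inl i)}
  have hT : T.ncard < c := by
    refine hf.ncard_lt_of_adj (v := Sum.inl i) ?_ ?_
    · rintro _ ⟨j, x, rfl, -⟩
      exact pathBlowup_adj_inl_inr.mpr hie
    · rintro _ ⟨j, x, -, h⟩
      exact h
  refine lt_of_le_of_lt ?_ hT
  have hinj : Function.Injective fun j : Fin m => some (e, j) := fun j j' h => by simpa using h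
  rw [← Set.ncard_image_of_injective _ hinj]
  refine (Set.ncard_le_ncard ?_).trans (Set.ncard_image_le (f := pathBlowupIndex))
  rintro _ ⟨j, ⟨x, hx⟩, rfl⟩
  exact ⟨Sum.inr (e, j, x), ⟨j, x, rfl, hx⟩, rfl⟩

lemma HasClustering.ncard_range_add_two_le [Finite V] {c r : ℕ}
    (hG : ∀ f : V → ℕ, HasClustering G f c → r ≤ (Set.range f).ncard)
    {f : Fin (c + 1) ⊕ Fin (c + 1) × Fin (2 * c) × V → ℕ}
    (hf : HasClustering (G.pathBlowup (c + 1) (2 * c)) f c) :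
    r + 2 ≤ (Set.range f).ncard := by
  obtain ⟨i, i', hii', hne⟩ := exists_pathBlowup_consecutive_ne hf
  have h₁ := ncard_pathBlowup_copies_lt hf (i := i) (e := i) (Or.inl rfl)
  have h₂ := ncard_pathBlowup_copies_lt hf (i := i') (e := i) (Or.inr hii'.symm)
  obtain ⟨j, hj⟩ : ∃ j : Fin (2 * c), ∀ x, f (Sum.inr (i, j, x)) ≠ f (Sum.inl i) ∧
      f (Sum.inr (i, j, x)) ≠ f (Sum.inl i') := by
    by_contra! hcon
    have hcover : (Set.univ : Set (Fin (2 * c))) ⊆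
        {j | ∃ x, f (Sum.inr (i, j, x)) = f (Sum.inl i)} ∪
          {j | ∃ x, f (Sum.inr (i, j, x)) = f (Sum.inl i')} := by
      intro j _
      obtain ⟨x, hx⟩ := hcon j
      by_cases h : f (Sum.inr (i, j, x)) = f (Sum.inl i)
      · exact Or.inl ⟨x, h⟩
      · exact Or.inr ⟨x, hx h⟩
    have := (Set.ncard_le_ncard hcover).trans (Set.ncard_union_le _ _)
    rw [Set.ncard_univ, Nat.card_fin] at this
    omega
  have hr := hG _ (hf.comp_embedding (pathBlowupCopy G i j))
  have hsub : insert (f (Sum.inl i)) (insert (f (Sum.inl i'))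
      (Set.range (f ∘ pathBlowupCopy G i j))) ⊆ Set.range f := by
    rintro _ (rfl | rfl | ⟨x, rfl⟩) <;> exact Set.mem_range_self _
  have hcard := Set.ncard_le_ncard hsub (Set.finite_range f)
  rw [Set.ncard_insert_of_notMem, Set.ncard_insert_of_notMem] at hcard
  · omega
  · rintro ⟨x, hx⟩
    exact (hj x).2 hx
  · rintro (h | ⟨x, hx⟩)
    · exact hne h
    · exact (hj x).1 hx

end pathBlowup

end SimpleGraph

open SimpleGraph

lemma closureTree_adj_nil {h k : ℕ} {l : List (Fin k)} (hl : l.length < h) (hne : l ≠ []) :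
    (closureTree h k).Adj ⟨[], Nat.zero_lt_of_lt hl⟩ ⟨l, hl⟩ := by
  simp [closureTree, hne.symm]

lemma closureTree_adj_cons {h k : ℕ} {a : Fin k} {l l' : List (Fin k)} (hl : l.length < h)
    (hl' : l'.length < h) (hadj : (closureTree h k).Adj ⟨l, hl⟩ ⟨l', hl'⟩) :
    (closureTree (h + 1) k).Adj ⟨a :: l, by simpa⟩ ⟨a :: l', by simpa⟩ := by
  simpa [closureTree] using hadj

/-- Three distinct natural numbers can be sorted. -/
lemma exists_lt_lt_of_injective (p : Fin 3 → ℕ) (hp : Function.Injective p) :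
    ∃ a b d, p a < p b ∧ p b < p d := by
  have h₁ : p 0 ≠ p 1 := hp.ne (by decide)
  have h₂ : p 0 ≠ p 2 := hp.ne (by decide)
  have h₃ : p 1 ≠ p 2 := hp.ne (by decide)
  rcases lt_or_gt_of_ne h₁ with h₁ | h₁ <;> rcases lt_or_gt_of_ne h₂ with h₂ | h₂ <;>
    rcases lt_or_gt_of_ne h₃ with h₃ | h₃
  exacts [⟨0, 1, 2, h₁, h₃⟩, ⟨0, 2, 1, h₂, h₃⟩, by omega, ⟨2, 0, 1, h₂, h₁⟩,
    ⟨1, 0, 2, h₁, h₂⟩, by omega, ⟨1, 2, 0, h₃, h₂⟩, ⟨2, 1, 0, h₃, h₁⟩]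

/-- In a model of `C(h+2,b)` in the blow-up of a graph without a `C(h+1,b)` minor, the branch sets
below each child of the root contain a vertex of the path. -/
lemma exists_inl_mem_of_model {V : Type*} {G : SimpleGraph V} {h b n m : ℕ}
    (hG : ¬ IsMinor (closureTree (h + 1) b) G)
    {X : {l : List (Fin b) // l.length < h + 2} → Set (Fin n ⊕ Fin n × Fin m × V)}
    (hconn : ∀ a, ((G.pathBlowup n m).induce (X a)).Connected)
    (hdisj : Pairwise fun s t => Disjoint (X s) (X t))
    (hadj : ∀ s t, (closureTree (h + 2) b).Adj s t →
      ∃ x ∈ X s, ∃ y ∈ X t, (G.pathBlowup n m).Adj x y) (a : Fin b) :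
    ∃ (l : List (Fin b)) (hl : l.length < h + 1) (p : Fin n),
      Sum.inl p ∈ X ⟨a :: l, by simpa using hl⟩ := by
  by_contra! hcon
  let Y (l : {l : List (Fin b) // l.length < h + 1}) := X ⟨a :: l.1, by simpa using l.2⟩
  have hY : ∀ l, ∀ w ∈ Y l, ∀ p, w ≠ Sum.inl p := by
    rintro l w hw p rfl
    exact hcon l.1 l.2 p hw
  have hindex : ∀ l, ∀ u ∈ Y l, ∀ v ∈ Y l, pathBlowupIndex u = pathBlowupIndex v :=
    fun l u hu v hv => eq_of_induce_connected (hconn _) pathBlowupIndex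
      (fun x hx y hy => pathBlowup_adj_index (hY l x hx) (hY l y hy)) hu hv
  let o : {l : List (Fin b) // l.length < h + 1} := ⟨[], by simp⟩
  obtain ⟨w, hw⟩ : (Y o).Nonempty := Set.nonempty_coe_sort.mp (hconn _).nonempty
  rcases w with p | ⟨e, j, x₀⟩
  · exact hY o _ hw p rfl
  have hcopy : ∀ l, Y l ⊆ Set.range (pathBlowupCopy G e j) := by
    intro l v hv
    have hv' : pathBlowupIndex v = some (e, j) := by
      by_cases hl : l = o
      · subst hl
        exact hindex _ v hv _ hw
      · obtain ⟨x, hx, y, hy, hxy⟩ := hadj _ _ (closureTree_adj_cons (a := a) o.2 l.2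
          (closureTree_adj_nil l.2 fun h => hl (Subtype.ext h)))
        rw [hindex l v hv y hy, ← pathBlowup_adj_index (hY o x hx) (hY l y hy) hxy]
        exact hindex o x hx _ hw
    rcases v with p | ⟨e', j', x⟩
    · exact absurd rfl (hY l _ hv p)
    · simp only [pathBlowupIndex, Option.some.injEq, Prod.mk.injEq] at hv'
      obtain ⟨rfl, rfl⟩ := hv'
      exact ⟨x, rfl⟩
  refine hG ⟨fun l => pathBlowupCopy G e j ⁻¹' Y l,
    fun l => induce_preimage_connected _ (hconn _) (hcopy l), fun l l' hne => ?_, ?_⟩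
  · refine Disjoint.preimage _ (hdisj fun h => hne (Subtype.ext ?_))
    simpa using h
  · intro l l' hll'
    obtain ⟨x, hx, y, hy, hxy⟩ := hadj _ _ (closureTree_adj_cons (a := a) l.2 l'.2 hll')
    obtain ⟨x, rfl⟩ := hcopy l hx
    obtain ⟨y, rfl⟩ := hcopy l' hy
    exact ⟨x, hx, y, hy, (pathBlowupCopy G e j).map_adj_iff.mp hxy⟩

/-- If `G` has no `C(h+1,3)` minor, then its blow-up along a path has no `C(h+2,3)` minor. -/
lemma not_isMinor_pathBlowup {V : Type*} {G : SimpleGraph V} {h n m : ℕ}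
    (hG : ¬ IsMinor (closureTree (h + 1) 3) G) :
    ¬ IsMinor (closureTree (h + 2) 3) (G.pathBlowup n m) := by
  rintro ⟨X, hconn, hdisj, hadj⟩
  choose l hl p hp using exists_inl_mem_of_model hG hconn hdisj hadj
  have hinj : Function.Injective fun a => (p a : ℕ) := by
    intro a a' haa'
    by_contra hne
    refine Set.disjoint_left.mp (hdisj ?_) (hp a) (Fin.ext haa' ▸ hp a')
    simp [hne]
  obtain ⟨a, b, d, hab, hbd⟩ := exists_lt_lt_of_injective _ hinj
  have havoid : ∀ s (hs : s.length < h + 2), ⟨s, hs⟩ ≠ (⟨b :: l b, by simpa using hl b⟩ :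
      {l : List (Fin 3) // l.length < h + 2}) → Sum.inl (p b) ∉ X ⟨s, hs⟩ :=
    fun s hs hne hmem => Set.disjoint_left.mp (hdisj hne) hmem (hp b)
  have hside : ∀ s (hs : s.length < h + 2), ⟨s, hs⟩ ≠ (⟨b :: l b, by simpa using hl b⟩ :
      {l : List (Fin 3) // l.length < h + 2}) → ∀ u ∈ X ⟨s, hs⟩, ∀ v ∈ X ⟨s, hs⟩,
      (pathBlowupPos u < 2 * p b ↔ pathBlowupPos v < 2 * p b) := by
    intro s hs hne u hu v hv
    refine Eq.to_iff (eq_of_induce_connected (hconn ⟨s, hs⟩)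
      (fun w => pathBlowupPos w < 2 * (p b : ℕ)) ?_ hu hv)
    intro x hx y hy hxy
    exact propext (pathBlowup_adj_pos_lt (fun h => havoid s hs hne (h ▸ hx))
      (fun h => havoid s hs hne (h ▸ hy)) hxy)
  obtain ⟨r, hr⟩ := (hconn ⟨[], by simp⟩).nonempty
  have hsame : ∀ a ≠ b, (pathBlowupPos r < 2 * (p b : ℕ) ↔
      pathBlowupPos (Sum.inl (p a) : Fin n ⊕ Fin n × Fin m × V) < 2 * (p b : ℕ)) := by
    intro a hne
    have hne' : (⟨a :: l a, by simpa using hl a⟩ : {l : List (Fin 3) // l.length < h + 2}) ≠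
        ⟨b :: l b, by simpa using hl b⟩ := by simp [hne]
    obtain ⟨x, hx, y, hy, hxy⟩ := hadj _ _
      (closureTree_adj_nil (l := a :: l a) (by simpa using hl a) (by simp))
    rw [hside _ _ (by simp) _ hr _ hx, ← hside _ _ hne' _ hy _ (hp a)]
    exact pathBlowup_adj_pos_lt (fun h => havoid _ _ (by simp) (h ▸ hx))
      (fun h => havoid _ _ hne' (h ▸ hy)) hxy
  have h₁ := hsame a (by rintro rfl; omega)
  have h₂ := hsame d (by rintro rfl; omega)
  simp only [pathBlowupPos] at h₁ h₂
  omega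

/-- There is a graph without a `C(h+1,3)` minor in which every colouring with clustering `c` uses
at least `2h` colours. -/
lemma exists_not_isMinor_and_two_mul_le_ncard_range (h c : ℕ) :
    ∃ (V : Type) (_ : Finite V) (G : SimpleGraph V),
      ¬ IsMinor (closureTree (h + 1) 3) G ∧
      ∀ f : V → ℕ, HasClustering G f c → 2 * h ≤ (Set.range f).ncard := by
  induction h with
  | zero =>
    refine ⟨Empty, inferInstance, ⊥, ?_, by simp⟩
    rintro ⟨X, hconn, -, -⟩
    obtain ⟨x, -⟩ := (hconn ⟨[], by simp⟩).nonempty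
    exact x.elim
  | succ h ih =>
    obtain ⟨V, _, G, hG, hf⟩ := ih
    exact ⟨_, inferInstance, G.pathBlowup (c + 1) (2 * c), not_isMinor_pathBlowup hG,
      fun f hc => HasClustering.ncard_range_add_two_le hf hc⟩

lemma ClusteredColourable.exists_hasClustering {V : Type*} [Finite V] {G : SimpleGraph V}
    {k c : ℕ} (hG : ClusteredColourable G k c) :
    ∃ f : V → ℕ, HasClustering G f c ∧ (Set.range f).ncard ≤ k := by
  obtain ⟨f, hf⟩ := hG
  refine ⟨fun v => f v, fun S hS hmono => ?_, ?_⟩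
  · obtain ⟨v, hv⟩ := hS.nonempty
    refine le_trans ?_ (hf v)
    have hsub : S ⊆ {u | f u = f v} := fun u hu => Fin.ext (hmono u hu v hv)
    rw [← Set.ncard_image_of_injective _ (Subtype.val_injective (p := (· ∈ {u | f u = f v})))]
    refine Set.ncard_le_ncard fun u hu => ⟨⟨u, hsub hu⟩, ?_, rfl⟩
    rw [ConnectedComponent.mem_supp_iff, ConnectedComponent.eq]
    exact (hS.preconnected ⟨u, hu⟩ ⟨v, hv⟩).map (induceHomOfLE G hsub).toHom
  · have hsub : Set.range (fun v => (f v : ℕ)) ⊆ Set.Iio k := by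
      rintro _ ⟨v, rfl⟩
      exact (f v).2
    simpa [Set.ncard_eq_toFinset_card'] using Set.ncard_le_ncard hsub (Set.finite_Iio k)

/-- For every `k ≥ 2` and `c ≥ 1` there is a graph `G` such that
`C(k,3)` is not a minor of `G` and `G` has no `(2k-3)`-colouring with clustering `c`. -/
theorem closureTree_ternary_lower_bound (k c : ℕ) (hk : 2 ≤ k) (hc : 1 ≤ c) :
    ∃ (V : Type) (_ : Finite V) (G : SimpleGraph V),
      ¬ IsMinor (closureTree k 3) G ∧
      ¬ ClusteredColourable G (2 * k - 3) c := by
  obtain ⟨V, hV, G, hG, hf⟩ := exists_not_isMinor_and_two_mul_le_ncard_range (k - 1) c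
  rw [Nat.sub_add_cancel (by omega)] at hG
  refine ⟨V, hV, G, hG, fun hcol => ?_⟩
  obtain ⟨f, hclust, hcard⟩ := hcol.exists_hasClustering
  have := hf f hclust
  omega
end

section
/- For all integers c ≥ 1 and n ≥ c² + c, the n-fan has no 2-colouring with clustering c. -/
/-- In a finite graph, a set of vertices which are all reachable from `v` within `s` has at most
as many elements as the component of `v` in the subgraph induced by `s`. -/
theorem card_le_ncard_supp_of_reachable_induce {V : Type*} [Finite V] {G : SimpleGraph V}
    {s : Set V} (v : s) (t : Finset V)
    (ht : ∀ x ∈ t, ∃ hx : x ∈ s, (G.induce s).Reachable ⟨x, hx⟩ v) :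
    t.card ≤ ((G.induce s).connectedComponentMk v).supp.ncard := by
  rw [← Set.ncard_coe_finset, ← Set.ncard_image_of_injective _ Subtype.val_injective]
  refine Set.ncard_le_ncard (fun x hx => ?_) (Set.toFinite _)
  obtain ⟨hxs, hreach⟩ := ht x hx
  exact ⟨⟨x, hxs⟩, SimpleGraph.ConnectedComponent.sound hreach, rfl⟩

theorem fan_adj_none_some {n : ℕ} (i : Fin n) : (fan n).Adj none (some i) := by
  simp [fan]

theorem fan_adj_some_some {n : ℕ} {i j : Fin n} (h : (i : ℕ) + 1 = j) :
    (fan n).Adj (some i) (some j) := by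
  have hij : i ≠ j := by rintro rfl; omega
  simp [fan, hij, h]

/-- In a set containing the interval of path vertices from `a` to `a + m`, the vertex `a + m` is
reachable from `a`. -/
theorem fan_induce_reachable_of_interval {n : ℕ} {s : Set (Option (Fin n))} {a : ℕ} (m : ℕ)
    (hm : a + m < n)
    (hs : ∀ k ≤ m, ∀ hk : a + k < n, some ⟨a + k, hk⟩ ∈ s) :
    ((fan n).induce s).Reachable ⟨some ⟨a + m, hm⟩, hs m le_rfl hm⟩
      ⟨some ⟨a, by omega⟩, hs 0 (Nat.zero_le m) (by omega)⟩ := by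
  induction m with
  | zero => exact SimpleGraph.Reachable.refl _
  | succ m ih =>
    refine SimpleGraph.Reachable.trans (SimpleGraph.Adj.reachable ?_)
      (ih (by omega) fun k hk => hs k (by omega))
    rw [SimpleGraph.induce_adj]
    exact (fan_adj_some_some (by simp only; omega)).symm

/-- For all `c ≥ 1` and `n ≥ c² + c`, the `n`-fan has no 2-colouring
with clustering `c`. -/
theorem fan_not_two_colourable (c n : ℕ) (hc : 1 ≤ c) (hn : c ^ 2 + c ≤ n) :
    ¬ ClusteredColourable (fan n) 2 c := by
  rintro ⟨f, hf⟩
  have hlt : ∀ b : Fin c, ∀ k : Fin (c + 1), (b : ℕ) * (c + 1) + k < n := by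
    intro b k
    have := b.2
    have := k.2
    nlinarith
  by_cases hblock : ∀ b : Fin c, ∃ k : Fin (c + 1), f (some ⟨b * (c + 1) + k, hlt b k⟩) = f none
  · choose k hk using hblock
    let p : Fin c → Fin n := fun b => ⟨b * (c + 1) + k b, hlt b (k b)⟩
    have hp : Function.Injective p := by
      intro b b' h
      have h' : (b : ℕ) * (c + 1) + k b = b' * (c + 1) + k b' := congrArg Fin.val h
      have hdiv : ∀ d : Fin c, ((d : ℕ) * (c + 1) + k d) / (c + 1) = d := fun d => by
        rw [Nat.mul_comm, Nat.mul_add_div (Nat.succ_pos c), Nat.div_eq_of_lt (k d).2, add_zero]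
      exact Fin.ext (by rw [← hdiv b, h', hdiv b'])
    have hcard := card_le_ncard_supp_of_reachable_induce (G := fan n)
      (s := {u | f u = f none}) ⟨none, rfl⟩ (Finset.univ.map ⟨p, hp⟩).insertNone (by
        intro x hx
        cases x with
        | none => exact ⟨rfl, SimpleGraph.Reachable.refl _⟩
        | some i =>
          obtain ⟨b, rfl⟩ : ∃ b, p b = i := by simpa using hx
          refine ⟨hk b, SimpleGraph.Adj.reachable ?_⟩
          rw [SimpleGraph.induce_adj]
          exact (fan_adj_none_some _).symm)
    have := hcard.trans (hf none)
    simp at this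
  · push Not at hblock
    obtain ⟨b, hb⟩ := hblock
    let v : Fin n := ⟨b * (c + 1), hlt b 0⟩
    have hmono : ∀ k ≤ c, ∀ hk : b * (c + 1) + k < n,
        f (some ⟨b * (c + 1) + k, hk⟩) = f (some v) := by
      intro k hkc hk
      have h₁ := hb ⟨k, by omega⟩
      have h₂ : f (some v) ≠ f none := hb 0
      simp only at h₁
      omega
    let q : Fin (c + 1) → Option (Fin n) := fun k => some ⟨b * (c + 1) + k, hlt b k⟩
    have hq : Function.Injective q := by
      intro k k' h
      simpa [q, Fin.ext_iff] using h
    have hcard := card_le_ncard_supp_of_reachable_induce (G := fan n)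
      (s := {u | f u = f (some v)}) ⟨some v, rfl⟩ (Finset.univ.map ⟨q, hq⟩) (by
        intro x hx
        obtain ⟨k, rfl⟩ : ∃ k, q k = x := by simpa using hx
        exact ⟨hmono k (by omega) (hlt b k), fan_induce_reachable_of_interval k (hlt b k)
          fun j hj => hmono j (by omega)⟩)
    have := hcard.trans (hf (some v))
    simp at this
end

section
/- For all integers c ≥ 1 and n ≥ c, the n-fat star has no 2-colouring with clustering c. -/
/-- A vertex with `n` distinct neighbours of its own colour lies in a monochromatic component
with more than `n` vertices. -/
theorem lt_ncard_monochromatic_component {V κ : Type*} [Finite V] (G : SimpleGraph V)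
    (f : V → κ) (v : V) {n : ℕ} (g : Fin n → V) (hg : Function.Injective g)
    (hadj : ∀ i, G.Adj v (g i)) (hcol : ∀ i, f (g i) = f v) :
    n < ((G.induce {u | f u = f v}).connectedComponentMk ⟨v, rfl⟩).supp.ncard := by
  let h : Option (Fin n) → {u | f u = f v} := fun o => o.elim ⟨v, rfl⟩ fun i => ⟨g i, hcol i⟩
  have hinj : Function.Injective h := by
    rintro (_ | i) (_ | j) hij
    · rfl
    · exact absurd (congrArg Subtype.val hij) (hadj j).ne
    · exact absurd (congrArg Subtype.val hij) (hadj i).ne'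
    · exact congrArg some (hg (congrArg Subtype.val hij))
  have hsub : Set.range h ⊆
      ((G.induce {u | f u = f v}).connectedComponentMk ⟨v, rfl⟩).supp := by
    rintro _ ⟨_ | i, rfl⟩
    · rfl
    · have hi : (G.induce {u | f u = f v}).Adj (h (some i)) ⟨v, rfl⟩ := (hadj i).symm
      exact SimpleGraph.ConnectedComponent.sound hi.reachable
  have hcard : (Set.range h).ncard = n + 1 := by
    rw [← Set.image_univ, Set.ncard_image_of_injective _ hinj, Set.ncard_univ]
    simp
  have hle := Set.ncard_le_ncard hsub
  lia

theorem fatStar_adj_centre (n : ℕ) (x : Fin n ⊕ Fin n × Fin n) :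
    (fatStar n).Adj (Sum.inl ()) (Sum.inr x) := by
  simp [fatStar]

theorem fatStar_adj_leaf (n : ℕ) (i j : Fin n) :
    (fatStar n).Adj (Sum.inr (Sum.inl i)) (Sum.inr (Sum.inr (i, j))) := by
  simp [fatStar]

/-- For all `c ≥ 1` and `n ≥ c`, the `n`-fat star has no 2-colouring
with clustering `c`. -/
theorem fatStar_not_two_colourable (c n : ℕ) (hc : 1 ≤ c) (hn : c ≤ n) :
    ¬ ClusteredColourable (fatStar n) 2 c := by
  rintro ⟨f, hf⟩
  -- Vertices other than the centre are grouped by the leaf they are or are attached to.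
  let p : Fin n ⊕ Fin n × Fin n → Fin n := Sum.elim id Prod.fst
  by_cases hall : ∀ i, ∃ x, p x = i ∧ f (Sum.inr x) = f (Sum.inl ())
  · choose g hgp hgf using hall
    have hg : Function.Injective fun i => (Sum.inr (g i) : Unit ⊕ Fin n ⊕ Fin n × Fin n) :=
      Sum.inr_injective.comp (Function.LeftInverse.injective hgp)
    have hlt := lt_ncard_monochromatic_component (fatStar n) f (Sum.inl ()) _ hg
      (fun i => fatStar_adj_centre n (g i)) hgf
    exact absurd (hf (Sum.inl ())) (by lia)
  · push Not at hall
    obtain ⟨i, hi⟩ := hall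
    have hleaf := hi (Sum.inl i) rfl
    have hcol : ∀ j, f (Sum.inr (Sum.inr (i, j))) = f (Sum.inr (Sum.inl i)) := fun j => by
      have hj := hi (Sum.inr (i, j)) rfl
      lia
    have hinj : Function.Injective fun j =>
        (Sum.inr (Sum.inr (i, j)) : Unit ⊕ Fin n ⊕ Fin n × Fin n) := fun j k hjk => by
      simpa using hjk
    have hlt := lt_ncard_monochromatic_component (fatStar n) f (Sum.inr (Sum.inl i)) _ hinj
      (fatStar_adj_leaf n i) hcol
    exact absurd (hf (Sum.inr (Sum.inl i))) (by lia)
end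

section
/- Let k ≥ 2 be an integer and let d := (k+2)·k^k·(18·k^{2k+1} + 1). Then every graph containing no k-fan minor, no k-fat path minor, and no k-fat star minor is 2-colourable with clustering k·d^{k^{3(k+2)k^k}}. -/
namespace ClusteredTwoColouring

open SimpleGraph

variable {V : Type*} {G : SimpleGraph V}

/-! ### Minors given by a relation -/

lemma isMinor_fromRel {α : Type*} {r : α → α → Prop} (X : α → Set V)
    (hconn : ∀ a, (G.induce (X a)).Connected)
    (hdisj : Pairwise fun a b => Disjoint (X a) (X b))
    (hadj : ∀ a b, r a b → ∃ x ∈ X a, ∃ y ∈ X b, G.Adj x y) :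
    IsMinor (SimpleGraph.fromRel r) G := by
  refine ⟨X, hconn, hdisj, fun a b hab => ?_⟩
  rcases ((SimpleGraph.fromRel_adj r a b).1 hab).2 with h | h
  · exact hadj a b h
  · obtain ⟨x, hx, y, hy, hxy⟩ := hadj b a h
    exact ⟨y, hy, x, hx, hxy.symm⟩

/-! ### Connected vertex sets -/

lemma induce_singleton_connected (v : V) : (G.induce {v}).Connected := by
  have : Nonempty ({v} : Set V) := ⟨⟨v, rfl⟩⟩
  exact ⟨fun a b => by rw [Subsingleton.elim a b]⟩

lemma induce_union_connected_of_forall_adj {s t : Set V} (hs : (G.induce s).Connected)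
    (ht : ∀ v ∈ t, ∃ a ∈ s, G.Adj a v) : (G.induce (s ∪ t)).Connected := by
  obtain ⟨u, hu⟩ := hs.nonempty
  refine G.induce_connected_of_patches u (Or.inl hu) fun {v} hv => ?_
  rcases hv with hv | hv
  · exact ⟨s, Set.subset_union_left, hu, hv, hs.preconnected _ _⟩
  · obtain ⟨a, ha, hav⟩ := ht v hv
    have h := induce_union_connected hs.preconnected
      (induce_pair_connected_of_adj hav).preconnected ⟨a, ha, by simp⟩
    refine ⟨s ∪ {a, v}, ?_, Or.inl hu, Or.inr (by simp), h.preconnected _ _⟩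
    rintro w (hw | rfl | rfl)
    exacts [Or.inl hw, Or.inl ha, Or.inr hv]

/-- The vertices outside `A` with a neighbour in `A`. -/
def outerNbr (G : SimpleGraph V) (A : Set V) : Set V := {v | v ∉ A ∧ ∃ a ∈ A, G.Adj a v}

/-! ### Long paths next to a connected set -/

lemma isMinor_fan {k : ℕ} {B : Set V} (hB : (G.induce B).Connected) {p : ℕ → V}
    (hinj : Set.InjOn p (Set.Iio k)) (hadj : ∀ i, i + 1 < k → G.Adj (p i) (p (i + 1)))
    (hp : ∀ i < k, p i ∈ outerNbr G B) : IsMinor (fan k) G := by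
  refine isMinor_fromRel (fun a => a.elim B fun i => {p i}) ?_ ?_ ?_
  · rintro (_ | i)
    · exact hB
    · exact induce_singleton_connected _
  · rintro (_ | i) (_ | j) hij
    · exact absurd rfl hij
    · exact Set.disjoint_singleton_right.2 (hp j j.2).1
    · exact Set.disjoint_singleton_left.2 (hp i i.2).1
    · refine Set.disjoint_singleton.2 fun h => hij ?_
      rw [Fin.ext (hinj i.2 j.2 h)]
  · rintro (_ | i) (_ | j) hij
    · exact hij.elim
    · obtain ⟨b, hb, hbj⟩ := (hp j j.2).2
      exact ⟨b, hb, p j, rfl, hbj⟩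
    · exact hij.elim
    · have hij : (i : ℕ) + 1 = j := hij
      refine ⟨p i, rfl, p j, rfl, ?_⟩
      rw [← hij]
      exact hadj i (by have := j.2; omega)

lemma isMinor_fan_of_long_path [Finite V] {k n : ℕ} {B Y : Set V}
    (hB : (G.induce B).Connected) (hY : Y.ncard ≤ n) {p : ℕ → V}
    (hinj : Set.InjOn p (Set.Iio ((n + 1) * k)))
    (hadj : ∀ i, i + 1 < (n + 1) * k → G.Adj (p i) (p (i + 1)))
    (hp : ∀ i < (n + 1) * k, p i ∉ Y → p i ∈ outerNbr G B) : IsMinor (fan k) G := by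
  have hlt : ∀ j < n + 1, ∀ i < k, j * k + i < (n + 1) * k := fun j hj i hi => by
    have := Nat.mul_le_mul_right k (Nat.succ_le_of_lt hj)
    rw [Nat.succ_mul] at this
    omega
  by_cases h : ∃ j < n + 1, ∀ i < k, p (j * k + i) ∉ Y
  · obtain ⟨j, hj, h⟩ := h
    refine isMinor_fan hB (p := fun i => p (j * k + i)) ?_ ?_ ?_
    · intro a ha b hb hab
      have := hinj (hlt j hj a ha) (hlt j hj b hb) hab
      omega
    · intro i hi
      exact hadj _ (hlt j hj (i + 1) hi)
    · exact fun i hi => hp _ (hlt j hj i hi) (h i hi)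
  · push Not at h
    choose! c hc hcY using h
    have : (Set.Iio (n + 1)).ncard ≤ Y.ncard := by
      refine Set.ncard_le_ncard_of_injOn (fun j => p (j * k + c j)) (fun j hj => hcY j hj) ?_
      intro a ha b hb hab
      have hab := hinj (hlt a ha _ (hc a ha)) (hlt b hb _ (hc b hb)) hab
      have hk : 0 < k := (Nat.zero_le _).trans_lt (hc a ha)
      have key : ∀ x < n + 1, (x * k + c x) / k = x := fun x hx => by
        rw [mul_comm, Nat.mul_add_div hk, Nat.div_eq_of_lt (hc x hx), add_zero]
      rw [← key a ha, ← key b hb, hab]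
    rw [← Finset.coe_Iio, Set.ncard_coe_finset, Nat.card_Iio] at this
    omega

/-! ### Absorbing vertices with many neighbours next to a connected set -/

/-- The vertices `x 0, …, x (m - 1)` are added to `A` one by one, each of them having, when it is
added, at least `D` neighbours among the outer neighbours of the current set. -/
def IsAbsorbing (G : SimpleGraph V) (A : Set V) (D m : ℕ) (x : ℕ → V) : Prop :=
  ∀ j < m, x j ∉ A ∪ x '' Set.Iio j ∧
    D ≤ (G.neighborSet (x j) ∩ outerNbr G (A ∪ x '' Set.Iio j)).ncard

lemma IsAbsorbing.exists_connected [Finite V] {A : Set V} (hA : (G.induce A).Connected) {D m : ℕ}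
    (hD : 0 < D) {x : ℕ → V} (hx : IsAbsorbing G A D m x) :
    ∃ Y : Set V, Y.ncard ≤ m ∧
      Y ⊆ (A ∪ x '' Set.Iio m) ∪ outerNbr G (A ∪ x '' Set.Iio m) ∧
      (G.induce ((A ∪ x '' Set.Iio m) ∪ Y)).Connected := by
  induction m with
  | zero =>
    have h : A ∪ x '' Set.Iio 0 ∪ ∅ = A := by simp
    exact ⟨∅, by simp, by simp, by rw [h]; exact hA⟩
  | succ m ih =>
    obtain ⟨Y, hYc, hYs, hY⟩ := ih fun j hj => hx j (by omega)
    obtain ⟨-, hm⟩ := hx m (by omega)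
    obtain ⟨y, hxy, hy, a, ha, hay⟩ := (Set.ncard_pos).1 (hD.trans_le hm)
    have hS : x '' Set.Iio (m + 1) = insert (x m) (x '' Set.Iio m) := by
      rw [← Set.image_insert_eq]
      congr 1
      ext i
      simp only [Set.mem_Iio, Set.mem_insert_iff]
      omega
    rw [hS]
    refine ⟨insert y Y, (Set.ncard_insert_le _ _).trans (by omega), ?_, ?_⟩
    · have key : ∀ z, (z ∈ A ∪ x '' Set.Iio m ∨ ∃ b ∈ A ∪ x '' Set.Iio m, G.Adj b z) →
          z ∈ (A ∪ insert (x m) (x '' Set.Iio m)) ∪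
            outerNbr G (A ∪ insert (x m) (x '' Set.Iio m)) := by
        have hsub : A ∪ x '' Set.Iio m ⊆ A ∪ insert (x m) (x '' Set.Iio m) :=
          Set.union_subset_union_right _ (Set.subset_insert _ _)
        rintro z (hz | ⟨b, hb, hbz⟩)
        · exact Or.inl (hsub hz)
        · by_cases hz : z ∈ A ∪ insert (x m) (x '' Set.Iio m)
          · exact Or.inl hz
          · exact Or.inr ⟨hz, b, hsub hb, hbz⟩
      rintro z (rfl | hz)
      · exact key _ (Or.inr ⟨a, ha, hay⟩)
      · exact key _ ((hYs hz).imp id And.right)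
    · have h1 := induce_union_connected_of_forall_adj (t := {y}) hY
        (by rintro v rfl; exact ⟨a, Or.inl ha, hay⟩)
      have h2 := induce_union_connected_of_forall_adj (t := {x m}) h1
        (by rintro v rfl; exact ⟨y, Or.inr rfl, G.adj_symm hxy⟩)
      have heq : A ∪ insert (x m) (x '' Set.Iio m) ∪ insert y Y =
          A ∪ x '' Set.Iio m ∪ Y ∪ {y} ∪ {x m} := by
        ext z
        simp only [Set.mem_union, Set.mem_insert_iff, Set.mem_singleton_iff]
        tauto
      rw [heq]
      exact h2

/-- A parent function on `{0, …, k ^ k}` rooted at `0` has a node with `k` children or a node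
of depth more than `k`. -/
lemma exists_children_or_deep {k : ℕ} (p : ℕ → ℕ) (hp0 : p 0 = 0)
    (hp : ∀ j ≤ k ^ k, 0 < j → p j < j) :
    (∃ i, k ≤ ((Finset.Ioc 0 (k ^ k)).filter fun j => p j = i).card) ∨
      ∃ j ≤ k ^ k, p^[k] j ≠ 0 := by
  by_contra! h
  obtain ⟨hw, hd⟩ := h
  have key : ∀ t, ((Finset.range (k ^ k + 1)).filter fun j => p^[t] j = 0).card ≤ k ^ t := by
    intro t
    induction t with
    | zero =>
      exact (Finset.card_le_card (t := {0}) fun j hj =>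
        Finset.mem_singleton.2 (Finset.mem_filter.1 hj).2).trans (by simp)
    | succ t ih =>
      rw [pow_succ, mul_comm]
      refine (Finset.card_le_mul_card_image_of_maps_to (f := p)
        (t := (Finset.range (k ^ k + 1)).filter fun j => p^[t] j = 0) ?_ k ?_).trans
        (Nat.mul_le_mul_left k ih)
      · intro j hj
        rw [Finset.mem_filter, Finset.mem_range, Function.iterate_succ_apply] at hj
        rw [Finset.mem_filter, Finset.mem_range]
        refine ⟨?_, hj.2⟩
        rcases Nat.eq_zero_or_pos j with rfl | h0
        · omega
        · have := hp j (by omega) h0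
          omega
      · intro i _
        refine (Finset.card_le_card (t := insert 0
          ((Finset.Ioc 0 (k ^ k)).filter fun j => p j = i)) ?_).trans
          ((Finset.card_insert_le _ _).trans (hw i))
        intro j hj
        simp only [Finset.mem_filter, Finset.mem_range, Finset.mem_insert, Finset.mem_Ioc] at hj ⊢
        rcases Nat.eq_zero_or_pos j with h0 | h0
        · exact Or.inl h0
        · exact Or.inr ⟨⟨h0, by omega⟩, hj.2⟩
  have hk := key k
  rw [Finset.filter_true_of_mem fun j hj => hd j (by rw [Finset.mem_range] at hj; omega),
    Finset.card_range] at hk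
  omega

/-- The branch sets of the nodes of the absorption tree: the root is `A` and node `j + 1` is
the absorbed vertex `x j`. -/
def node (A : Set V) (x : ℕ → V) : ℕ → Set V
  | 0 => A
  | j + 1 => {x j}

lemma node_connected {A : Set V} (hA : (G.induce A).Connected) (x : ℕ → V) (i : ℕ) :
    (G.induce (node A x i)).Connected := by
  cases i with
  | zero => exact hA
  | succ i => exact induce_singleton_connected _

lemma IsAbsorbing.notMem {A : Set V} {D m : ℕ} {x : ℕ → V} (hx : IsAbsorbing G A D m x)
    {j : ℕ} (hj : j < m) : x j ∉ A :=
  fun h => (hx j hj).1 (Or.inl h)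

lemma IsAbsorbing.injOn {A : Set V} {D m : ℕ} {x : ℕ → V} (hx : IsAbsorbing G A D m x) :
    ∀ i < m, ∀ j < m, x i = x j → i = j := by
  intro i hi j hj hij
  rcases lt_trichotomy i j with h | h | h
  · exact ((hx j hj).1 (Or.inr ⟨i, h, hij⟩)).elim
  · exact h
  · exact ((hx i hi).1 (Or.inr ⟨j, h, hij.symm⟩)).elim

/-- The vertex `c` is adjacent to `x j` and to node `i`, and lies in no node. -/
def IsCommonNbr (G : SimpleGraph V) (A : Set V) (x : ℕ → V) (m i j : ℕ) (c : V) : Prop :=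
  c ∉ A ∧ (∀ l < m, c ≠ x l) ∧ G.Adj (x j) c ∧ ∃ a ∈ node A x i, G.Adj a c

lemma IsAbsorbing.exists_parent [Finite V] {A : Set V} {k m : ℕ} {x : ℕ → V}
    (hx : IsAbsorbing G A ((k + 2) * m ^ 2) m x) {j : ℕ} (hj : j < m) :
    ∃ i ≤ j, ∃ E : Finset V, (k + 1) * m ≤ E.card ∧ ∀ c ∈ E, IsCommonNbr G A x m i j c := by
  classical
  let T : Finset V :=
    (Set.toFinite (G.neighborSet (x j) ∩ outerNbr G (A ∪ x '' Set.Iio j))).toFinset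
  let C : Finset V := T \ (Finset.range m).image x
  have hcard : (k + 2) * m ^ 2 ≤ C.card + m := by
    have h1 : (k + 2) * m ^ 2 ≤ T.card := by
      rw [← Set.ncard_eq_toFinset_card]
      exact (hx j hj).2
    have h2 : T.card - ((Finset.range m).image x).card ≤ C.card := Finset.le_card_sdiff _ _
    have h3 : ((Finset.range m).image x).card ≤ m := by
      simpa using Finset.card_image_le (s := Finset.range m) (f := x)
    omega
  have hCprop : ∀ c ∈ C, ∃ i ≤ j, IsCommonNbr G A x m i j c := by
    intro c hc
    rw [Finset.mem_sdiff, Set.Finite.mem_toFinset] at hc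
    obtain ⟨⟨hxc, hcA, a, ha, hac⟩, hcx⟩ := hc
    have h1 : c ∉ A := fun h => hcA (Or.inl h)
    have h2 : ∀ l < m, c ≠ x l := fun l hl h =>
      hcx (Finset.mem_image.2 ⟨l, Finset.mem_range.2 hl, h.symm⟩)
    rcases ha with ha | ⟨i, hi, rfl⟩
    · exact ⟨0, Nat.zero_le _, h1, h2, hxc, a, ha, hac⟩
    · exact ⟨i + 1, hi, h1, h2, hxc, x i, rfl, hac⟩
  choose! f hf hfc using hCprop
  obtain ⟨i, hi, hE⟩ := Finset.exists_le_card_fiber_of_mul_le_card_of_maps_to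
    (s := C) (t := Finset.range (j + 1)) (f := f) (n := (k + 1) * m)
    (fun c hc => Finset.mem_range.2 (Nat.lt_succ_of_le (hf c hc))) ⟨0, by simp⟩ (by
      rw [Finset.card_range]
      have h1 : (j + 1) * ((k + 1) * m) ≤ m * ((k + 1) * m) := Nat.mul_le_mul_right _ hj
      have h2 : m ≤ m * m := Nat.le_mul_self m
      nlinarith)
  refine ⟨i, Nat.lt_succ_iff.1 (Finset.mem_range.1 hi), _, hE, fun c hc => ?_⟩
  obtain ⟨hcC, rfl⟩ := Finset.mem_filter.1 hc
  exact hfc c hcC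

lemma IsAbsorbing.exists_tree [Finite V] {A : Set V} {k m : ℕ} {x : ℕ → V}
    (hx : IsAbsorbing G A ((k + 2) * m ^ 2) m x) :
    ∃ (p : ℕ → ℕ) (c : ℕ → Fin (k + 1) → V), p 0 = 0 ∧ (∀ j < m, p (j + 1) ≤ j) ∧
      (∀ j < m, ∀ l, IsCommonNbr G A x m (p (j + 1)) j (c j l)) ∧
      ∀ j < m, ∀ j' < m, ∀ l l', c j l = c j' l' → j = j' ∧ l = l' := by
  classical
  choose! p hp E hE hEc using fun j (hj : j < m) => hx.exists_parent hj
  obtain ⟨c, hinj, hc⟩ := (Finset.all_card_le_biUnion_card_iff_exists_injective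
    (fun a : Fin m × Fin (k + 1) => E a.1)).1 (by
      intro s
      rcases s.eq_empty_or_nonempty with rfl | ⟨a, ha⟩
      · simp
      · calc s.card ≤ Fintype.card (Fin m × Fin (k + 1)) := Finset.card_le_univ s
          _ = (k + 1) * m := by simp [mul_comm]
          _ ≤ (E a.1).card := hE _ a.1.2
          _ ≤ _ := Finset.card_le_card
            (Finset.subset_biUnion_of_mem (fun a : Fin m × Fin (k + 1) => E a.1) ha))
  refine ⟨fun j => j.casesOn 0 p, fun j l => if h : j < m then c (⟨j, h⟩, l) else x 0, rfl, hp,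
    ?_, ?_⟩
  · intro j hj l
    simp only [hj, dif_pos]
    exact hEc j hj _ (hc (⟨j, hj⟩, l))
  · intro j hj j' hj' l l' h
    simp only [hj, hj', dif_pos] at h
    simpa using hinj h

lemma isMinor_fatStar {A : Set V} (hA : (G.induce A).Connected) {k m D : ℕ} {x : ℕ → V}
    (hx : IsAbsorbing G A D m x) {p : ℕ → ℕ} {c : ℕ → Fin (k + 1) → V}
    (hp : ∀ j < m, p (j + 1) ≤ j)
    (hc : ∀ j < m, ∀ l, IsCommonNbr G A x m (p (j + 1)) j (c j l))
    (hinj : ∀ j < m, ∀ j' < m, ∀ l l', c j l = c j' l' → j = j' ∧ l = l')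
    {i : ℕ} {e : Fin k → ℕ} (he : Function.Injective e) (hem : ∀ a, e a < m)
    (hei : ∀ a, p (e a + 1) = i) : IsMinor (fatStar k) G := by
  have hnode : ∀ a, x (e a) ∉ node A x i := by
    intro a h
    have hle := hp _ (hem a)
    rw [hei a] at hle
    cases i with
    | zero => exact hx.notMem (hem a) h
    | succ i =>
      have := hx.injOn _ (hem a) i (by have := hem a; omega) h
      omega
  have hcnode : ∀ a l, c (e a) l ∉ node A x i := by
    intro a l h
    have hle := hp _ (hem a)
    rw [hei a] at hle
    cases i with
    | zero => exact (hc _ (hem a) l).1 h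
    | succ i => exact (hc _ (hem a) l).2.1 i (by have := hem a; omega) h
  have hadj : ∀ a l, ∃ b ∈ node A x i, G.Adj b (c (e a) l) := fun a l => by
    have := (hc _ (hem a) l).2.2.2
    rwa [hei a] at this
  have hxc : ∀ a b l, x (e a) ≠ c (e b) l :=
    fun a b l h => (hc _ (hem b) l).2.1 _ (hem a) h.symm
  have hcc : ∀ a b l l', c (e a) l = c (e b) l' → a = b ∧ l = l' := fun a b l l' h =>
    (hinj _ (hem a) _ (hem b) l l' h).imp_left fun h => he h
  let X : Unit ⊕ Fin k ⊕ Fin k × Fin k → Set V :=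
    Sum.elim (fun _ => node A x i)
      (Sum.elim (fun a => {x (e a), c (e a) (Fin.last k)}) fun al => {c (e al.1) al.2.castSucc})
  refine isMinor_fromRel X ?_ ?_ ?_
  · rintro (_ | a | ⟨a, l⟩)
    · exact node_connected hA x i
    · exact induce_pair_connected_of_adj (hc _ (hem a) _).2.2.1
    · exact induce_singleton_connected _
  · have hCL : ∀ a, Disjoint (node A x i) {x (e a), c (e a) (Fin.last k)} := by
      intro a
      simp [hnode, hcnode]
    have hCS : ∀ a l, Disjoint (node A x i) {c (e a) l} := by
      intro a l
      simp [hcnode]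
    have hLS : ∀ a b (l : Fin k),
        Disjoint ({x (e a), c (e a) (Fin.last k)} : Set V) {c (e b) l.castSucc} := by
      intro a b l
      rw [Set.disjoint_singleton_right]
      rintro (h | h)
      · exact hxc _ _ _ h.symm
      · exact (Fin.castSucc_lt_last l).ne (hcc _ _ _ _ h).2
    rintro (u | a | ⟨a, l⟩) (u' | b | ⟨b, l'⟩) hab
    · exact absurd rfl hab
    · exact hCL b
    · exact hCS b _
    · exact (hCL a).symm
    · rw [Set.disjoint_left]
      have hne : a ≠ b := fun h => hab (by rw [h])
      rintro v (rfl | rfl) (h | h)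
      · exact hne (he (hx.injOn _ (hem a) _ (hem b) h))
      · exact hxc _ _ _ h
      · exact hxc _ _ _ h.symm
      · exact hne (hcc _ _ _ _ h).1
    · exact hLS a b l'
    · exact (hCS a _).symm
    · exact (hLS b a l).symm
    · refine Set.disjoint_singleton.2 fun h => hab ?_
      obtain ⟨h1, h2⟩ := hcc a b l.castSucc l'.castSucc h
      rw [h1, Fin.castSucc_injective k h2]
  · rintro (u | a | ⟨a, l⟩) (u' | b | ⟨b, l'⟩) hab
    · exact hab.elim
    · obtain ⟨v, hv, hvc⟩ := hadj b (Fin.last k)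
      exact ⟨v, hv, _, Or.inr rfl, hvc⟩
    · obtain ⟨v, hv, hvc⟩ := hadj b l'.castSucc
      exact ⟨v, hv, _, rfl, hvc⟩
    · exact hab.elim
    · exact hab.elim
    · obtain rfl : a = b := hab
      exact ⟨_, Or.inl rfl, _, rfl, (hc _ (hem a) _).2.2.1⟩
    · exact hab.elim
    · exact hab.elim
    · exact hab.elim

lemma isMinor_fatPath {A : Set V} {k m D : ℕ} {x : ℕ → V}
    (hx : IsAbsorbing G A D m x) {p : ℕ → ℕ} {c : ℕ → Fin (k + 1) → V}
    (hc : ∀ j < m, ∀ l, IsCommonNbr G A x m (p (j + 1)) j (c j l))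
    (hinj : ∀ j < m, ∀ j' < m, ∀ l l', c j l = c j' l' → j = j' ∧ l = l')
    {e : ℕ → ℕ} (he : ∀ a < k, ∀ b < k, e a = e b → a = b) (hem : ∀ a < k, e a < m)
    (hep : ∀ a, a + 1 < k → p (e a + 1) = e (a + 1) + 1) : IsMinor (fatPath k) G := by
  have hadj : ∀ a, a + 1 < k → ∀ l, G.Adj (x (e (a + 1))) (c (e a) l) := fun a ha l => by
    obtain ⟨b, hb, hbc⟩ := (hc _ (hem a (by omega)) l).2.2.2
    rw [hep a ha] at hb
    obtain rfl : b = x (e (a + 1)) := hb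
    exact hbc
  have hxc : ∀ a < k, ∀ b < k, ∀ l, x (e a) ≠ c (e b) l :=
    fun a ha b hb l h => (hc _ (hem b hb) l).2.1 _ (hem a ha) h.symm
  have hcc : ∀ a < k, ∀ b < k, ∀ l l', c (e a) l = c (e b) l' → a = b ∧ l = l' :=
    fun a ha b hb l l' h =>
      (hinj _ (hem a ha) _ (hem b hb) l l' h).imp_left fun h => he a ha b hb h
  let X : Fin k ⊕ Fin (k - 1) × Fin k → Set V :=
    Sum.elim (fun a => {x (e a), c (e a) (Fin.last k)}) fun al => {c (e al.1) al.2.castSucc}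
  have hlt : ∀ a : Fin (k - 1), (a : ℕ) + 1 < k := fun a => by have := a.2; omega
  refine isMinor_fromRel X ?_ ?_ ?_
  · rintro (a | ⟨a, l⟩)
    · exact induce_pair_connected_of_adj (hc _ (hem a a.2) _).2.2.1
    · exact induce_singleton_connected _
  · have hLS : ∀ (a : Fin k) (b : Fin (k - 1)) (l : Fin k),
        Disjoint ({x (e a), c (e a) (Fin.last k)} : Set V) {c (e b) l.castSucc} := by
      intro a b l
      rw [Set.disjoint_singleton_right]
      rintro (h | h)
      · exact hxc _ a.2 _ (by have := hlt b; omega) _ h.symm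
      · exact (Fin.castSucc_lt_last l).ne (hcc _ (by have := hlt b; omega) _ a.2 _ _ h).2
    rintro (a | ⟨a, l⟩) (b | ⟨b, l'⟩) hab
    · rw [Set.disjoint_left]
      have hne : (a : ℕ) ≠ b := fun h => hab (by rw [Fin.ext h])
      rintro v (rfl | rfl) (h | h)
      · exact hne (he _ a.2 _ b.2 (hx.injOn _ (hem a a.2) _ (hem b b.2) h))
      · exact hxc _ a.2 _ b.2 _ h
      · exact hxc _ b.2 _ a.2 _ h.symm
      · exact hne (hcc _ a.2 _ b.2 _ _ h).1
    · exact hLS a b l'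
    · exact (hLS b a l).symm
    · refine Set.disjoint_singleton.2 fun h => hab ?_
      obtain ⟨h1, h2⟩ := hcc a (by have := hlt a; omega) b (by have := hlt b; omega)
        l.castSucc l'.castSucc h
      rw [Fin.ext h1, Fin.castSucc_injective k h2]
  · rintro (a | ⟨a, l⟩) (b | ⟨b, l'⟩) hab
    · have hab : (a : ℕ) + 1 = b := hab
      refine ⟨_, Or.inr rfl, _, Or.inl rfl, ?_⟩
      rw [← hab]
      exact (hadj _ (by have := b.2; omega) _).symm
    · have hab : (a : ℕ) = b ∨ (a : ℕ) = b + 1 := hab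
      refine ⟨_, Or.inl rfl, _, rfl, ?_⟩
      rcases hab with h | h
      · rw [h]
        exact (hc _ (hem b (by have := hlt b; omega)) _).2.2.1
      · rw [h]
        exact hadj _ (hlt b) _
    · exact hab.elim
    · exact hab.elim

lemma not_isAbsorbing [Finite V] {k : ℕ} (h2 : ¬ IsMinor (fatPath k) G)
    (h3 : ¬ IsMinor (fatStar k) G) {A : Set V} (hA : (G.induce A).Connected) (x : ℕ → V) :
    ¬ IsAbsorbing G A ((k + 2) * (k ^ k) ^ 2) (k ^ k) x := by
  intro hx
  obtain ⟨p, c, hp0, hp, hc, hinj⟩ := hx.exists_tree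
  have hpred : ∀ j ≤ k ^ k, 0 < j → p j < j := by
    intro j hj h0
    obtain ⟨j, rfl⟩ := Nat.exists_eq_succ_of_ne_zero h0.ne'
    exact Nat.lt_succ_of_le (hp j hj)
  rcases exists_children_or_deep p hp0 hpred with ⟨i, hi⟩ | ⟨j, hj, hdeep⟩
  · have hmem := fun a => Finset.mem_filter.1 (Finset.orderEmbOfCardLe_mem _ hi a)
    simp only [Finset.mem_Ioc] at hmem
    refine h3 (isMinor_fatStar hA hx hp hc hinj (i := i)
      (e := fun a => Finset.orderEmbOfCardLe _ hi a - 1) ?_ ?_ ?_)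
    · intro a b hab
      have ha := hmem a
      have hb := hmem b
      apply (Finset.orderEmbOfCardLe _ hi).injective
      dsimp only at hab
      omega
    · intro a
      have ha := hmem a
      omega
    · intro a
      rw [Nat.sub_add_cancel (hmem a).1.1, (hmem a).2]
  · have hpos : ∀ t ≤ k, 0 < p^[t] j := by
      intro t ht
      rw [Nat.pos_iff_ne_zero]
      intro h
      apply hdeep
      rw [← Nat.sub_add_cancel ht, Function.iterate_add_apply, h, Function.iterate_fixed hp0]
    have hle : ∀ t ≤ k, p^[t] j ≤ k ^ k := by
      intro t
      induction t with
      | zero => exact fun _ => hj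
      | succ t ih =>
        intro ht
        rw [Function.iterate_succ_apply']
        exact (hpred _ (ih (by omega)) (hpos t (by omega))).le.trans (ih (by omega))
    have hanti : ∀ s t, t ≤ k → s < t → p^[t] j < p^[s] j := by
      intro s t ht hst
      induction t, hst using Nat.le_induction with
      | base =>
        rw [Function.iterate_succ_apply']
        exact hpred _ (hle s (by omega)) (hpos s (by omega))
      | succ t _ ih =>
        rw [Function.iterate_succ_apply']
        exact (hpred _ (hle t (by omega)) (hpos t (by omega))).trans (ih (by omega))
    refine h2 (isMinor_fatPath hx hc hinj (e := fun t => p^[t] j - 1) ?_ ?_ ?_)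
    · intro a ha b hb hab
      have h1 := hpos a ha.le
      have h2 := hpos b hb.le
      rcases lt_trichotomy a b with h | h | h
      · have := hanti a b hb.le h
        omega
      · exact h
      · have := hanti b a ha.le h
        omega
    · intro a ha
      have h1 := hpos a ha.le
      have h2 := hle a ha.le
      omega
    · intro a ha
      rw [Nat.sub_add_cancel (hpos a (by omega)), Nat.sub_add_cancel (hpos (a + 1) ha.le),
        Function.iterate_succ_apply']

lemma exists_absorbed_set [Finite V] {k : ℕ} (hk : 0 < k) (h2 : ¬ IsMinor (fatPath k) G)
    (h3 : ¬ IsMinor (fatStar k) G) {A : Set V} (hA : (G.induce A).Connected) :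
    ∃ S Y : Set V, S.ncard ≤ k ^ k ∧ Y.ncard ≤ k ^ k ∧ Y ⊆ (A ∪ S) ∪ outerNbr G (A ∪ S) ∧
      (G.induce ((A ∪ S) ∪ Y)).Connected ∧
      ∀ v ∉ A ∪ S,
        (G.neighborSet v ∩ outerNbr G (A ∪ S)).ncard < (k + 2) * (k ^ k) ^ 2 := by
  classical
  have hM : 0 < k ^ k := Nat.pow_pos hk
  set D := (k + 2) * (k ^ k) ^ 2
  have hD0 : 0 < D := by positivity
  have hex : ∃ m, ¬ ∃ x, IsAbsorbing G A D m x :=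
    ⟨k ^ k, fun ⟨x, hx⟩ => not_isAbsorbing h2 h3 hA x hx⟩
  obtain ⟨u, hu⟩ := hA.nonempty
  obtain ⟨m, hm⟩ : ∃ m, Nat.find hex = m + 1 := by
    refine Nat.exists_eq_succ_of_ne_zero fun h => ?_
    have := Nat.find_spec hex
    rw [h] at this
    exact this ⟨fun _ => u, fun j hj => absurd hj (Nat.not_lt_zero j)⟩
  have hle : m ≤ k ^ k := by
    have : Nat.find hex ≤ k ^ k := Nat.find_min' hex fun ⟨x, hx⟩ => not_isAbsorbing h2 h3 hA x hx
    omega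
  have hmax : ¬ ∃ x, IsAbsorbing G A D (m + 1) x := hm ▸ Nat.find_spec hex
  obtain ⟨x, hx⟩ := not_not.1 (Nat.find_min hex (m := m) (by omega))
  obtain ⟨Y, hYc, hYs, hY⟩ := hx.exists_connected hA hD0
  refine ⟨x '' Set.Iio m, Y, ?_, hYc.trans hle, hYs, hY, fun v hv => ?_⟩
  · refine (Set.ncard_image_le (Set.finite_Iio m)).trans ?_
    rwa [← Finset.coe_Iio, Set.ncard_coe_finset, Nat.card_Iio]
  · by_contra! hdeg
    refine hmax ⟨Function.update x m v, fun j hj => ?_⟩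
    have himg : Function.update x m v '' Set.Iio j = x '' Set.Iio j :=
      Set.image_congr fun i hi => Function.update_of_ne (by have : i < j := hi; omega) _ _
    rw [himg]
    rcases Nat.lt_succ_iff_lt_or_eq.1 hj with h | rfl
    · rw [Function.update_of_ne h.ne]
      exact hx j h
    · rw [Function.update_self]
      exact ⟨hv, hdeg⟩

/-! ### Layerings -/

lemma exists_layers [Finite V] {k : ℕ} (hk : 0 < k) (h2 : ¬ IsMinor (fatPath k) G)
    (h3 : ¬ IsMinor (fatStar k) G) (r : V) :
    ∃ W S Y : ℕ → Set V, W 0 = {r} ∪ S 0 ∧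
      (∀ n, W (n + 1) = (W n ∪ outerNbr G (W n)) ∪ S (n + 1)) ∧
      (∀ n, (S n).ncard ≤ k ^ k) ∧ (∀ n, (Y n).ncard ≤ k ^ k) ∧
      (∀ n, (G.induce (W n ∪ Y n)).Connected) ∧
      ∀ n, ∀ v ∉ W n,
        (G.neighborSet v ∩ outerNbr G (W n)).ncard < (k + 2) * (k ^ k) ^ 2 := by
  choose S Y hS hY hYs hconn hdeg using
    fun A : {A : Set V // (G.induce A).Connected} => exists_absorbed_set hk h2 h3 A.2
  let next : {A : Set V // (G.induce A).Connected} → {A : Set V // (G.induce A).Connected} :=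
    fun A => ⟨(A.1 ∪ S A) ∪ outerNbr G (A.1 ∪ S A), by
      have h := induce_union_connected_of_forall_adj (t := outerNbr G (A.1 ∪ S A)) (hconn A)
        fun v hv => hv.2.imp fun a ha => ⟨Or.inl ha.1, ha.2⟩
      rwa [Set.union_right_comm, Set.union_eq_self_of_subset_right (hYs A)] at h⟩
  let A : ℕ → {A : Set V // (G.induce A).Connected} :=
    fun n => next^[n] ⟨{r}, induce_singleton_connected r⟩
  refine ⟨fun n => (A n).1 ∪ S (A n), fun n => S (A n), fun n => Y (A n), rfl, fun n => ?_,
    fun n => hS _, fun n => hY _, fun n => hconn _, fun n => hdeg _⟩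
  have hA : A (n + 1) = next (A n) := Function.iterate_succ_apply' _ _ _
  change (A (n + 1)).1 ∪ _ = _
  nth_rewrite 1 [hA]
  rfl

lemma exists_layering [Finite V] {k : ℕ} (hk : 0 < k) (h1 : ¬ IsMinor (fan k) G)
    (h2 : ¬ IsMinor (fatPath k) G) (h3 : ¬ IsMinor (fatStar k) G) (r : V) :
    ∃ ρ : V → ℕ, (∀ u v, G.Reachable r u → G.Adj u v → ρ v ≤ ρ u + 1) ∧
      (∀ u, G.Reachable r u →
        {w | G.Adj u w ∧ ρ w = ρ u}.ncard + 1 ≤ (k + 2) * (k ^ k) ^ 2 + k ^ k) ∧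
      ∀ (p : ℕ → V) (t : ℕ),
        (∀ i < (2 * k ^ k + 1) * k, G.Reachable r (p i) ∧ ρ (p i) = t) →
        Set.InjOn p (Set.Iio ((2 * k ^ k + 1) * k)) →
        ¬ ∀ i, i + 1 < (2 * k ^ k + 1) * k → G.Adj (p i) (p (i + 1)) := by
  obtain ⟨W, S, Y, hW0, hW, hS, hY, hconn, hdeg⟩ := exists_layers hk h2 h3 r
  have hM : 0 < k ^ k := Nat.pow_pos hk
  have hstep : ∀ n, ∀ u ∈ W n, ∀ v, G.Adj u v → v ∈ W (n + 1) := by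
    intro n u hu v huv
    rw [hW]
    by_cases hv : v ∈ W n
    · exact Or.inl (Or.inl hv)
    · exact Or.inl (Or.inr ⟨hv, u, hu, huv⟩)
  have hcover : ∀ u, G.Reachable r u → ∃ n, u ∈ W n := by
    intro u hu
    rw [reachable_iff_reflTransGen] at hu
    induction hu with
    | refl => exact ⟨0, by rw [hW0]; exact Or.inl rfl⟩
    | tail _ huv ih =>
      obtain ⟨n, hn⟩ := ih
      exact ⟨n + 1, hstep n _ hn _ huv⟩
  let ρ : V → ℕ := fun v => sInf {n | v ∈ W n}
  have hmem : ∀ u, G.Reachable r u → u ∈ W (ρ u) := fun u hu => Nat.sInf_mem (hcover u hu)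
  have hnot : ∀ u n, n < ρ u → u ∉ W n := fun u n hn h => Nat.notMem_of_lt_sInf hn h
  have hclass : ∀ u t, G.Reachable r u → ρ u = t + 1 → u ∈ outerNbr G (W t) ∪ S (t + 1) := by
    intro u t hu ht
    have h := hmem u hu
    rw [ht, hW] at h
    rcases h with (h | h) | h
    · exact absurd h (hnot u t (by omega))
    · exact Or.inl h
    · exact Or.inr h
  have hW0card : (W 0).ncard ≤ k ^ k + 1 := by
    rw [hW0]
    refine (Set.ncard_union_le _ _).trans ?_
    have := hS 0
    rw [Set.ncard_singleton]
    omega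
  refine ⟨ρ, fun u v hu huv => Nat.sInf_le (hstep _ _ (hmem u hu) _ huv), fun u hu => ?_, ?_⟩
  · have hreach : ∀ w, G.Adj u w → G.Reachable r w := fun w hw => hu.trans hw.reachable
    rcases Nat.eq_zero_or_eq_succ_pred (ρ u) with h0 | hs
    · have hsub : {w | G.Adj u w ∧ ρ w = ρ u} ⊆ W 0 := by
        rintro w ⟨hw, hwu⟩
        have := hmem w (hreach w hw)
        rwa [hwu, h0] at this
      have h := (Set.ncard_le_ncard hsub).trans hW0card
      have : 1 ≤ (k ^ k) ^ 2 := Nat.pow_pos hM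
      nlinarith
    · have hsub : {w | G.Adj u w ∧ ρ w = ρ u} ⊆
          (G.neighborSet u ∩ outerNbr G (W (ρ u).pred)) ∪ S (ρ u) := by
        rintro w ⟨hw, hwu⟩
        rcases hclass w _ (hreach w hw) (hwu.trans hs) with h | h
        · exact Or.inl ⟨hw, h⟩
        · exact Or.inr (hs ▸ h)
      have h := (Set.ncard_le_ncard hsub).trans (Set.ncard_union_le _ _)
      have h4 := hdeg _ u (hnot u (ρ u).pred (by omega))
      have h5 := hS (ρ u)
      omega
  · intro p t hp hinj hadj
    cases t with
    | zero =>
      refine h1 (isMinor_fan_of_long_path (n := 2 * k ^ k) (Y := W 0)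
        (induce_singleton_connected r) (by omega) hinj hadj fun i hi hiW => ?_)
      have := hmem _ (hp i hi).1
      rw [(hp i hi).2] at this
      exact absurd this hiW
    | succ t =>
      refine h1 (isMinor_fan_of_long_path (n := 2 * k ^ k) (Y := Y t ∪ S (t + 1)) (hconn t)
        ((Set.ncard_union_le _ _).trans (by have := hY t; have := hS (t + 1); omega))
        hinj hadj fun i hi hiY => ?_)
      rcases hclass _ t (hp i hi).1 (hp i hi).2 with ⟨h, a, ha, hap⟩ | h
      · exact ⟨fun h' => h'.elim h fun h' => hiY (Or.inl h'), a, Or.inl ha, hap⟩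
      · exact absurd (Or.inr h) hiY

/-! ### Bounding the monochromatic components -/

lemma ncard_walk_length_le {W : Type*} [Finite W] {H : SimpleGraph W} {Δ : ℕ}
    (hdeg : ∀ v, (H.neighborSet v).ncard + 1 ≤ Δ) (n : ℕ) (v : W) :
    {u | ∃ w : H.Walk v u, w.length ≤ n}.ncard ≤ Δ ^ n := by
  classical
  induction n generalizing v with
  | zero =>
    rw [pow_zero, Set.ncard_le_one_iff]
    rintro a b ⟨w, hw⟩ ⟨w', hw'⟩
    rw [← Walk.eq_of_length_eq_zero (Nat.le_zero.1 hw),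
      ← Walk.eq_of_length_eq_zero (Nat.le_zero.1 hw')]
  | succ n ih =>
    let N : Finset W := (Set.toFinite (insert v (H.neighborSet v))).toFinset
    let T : W → Finset W := fun a => (Set.toFinite {u | ∃ w : H.Walk a u, w.length ≤ n}).toFinset
    have hsub : {u | ∃ w : H.Walk v u, w.length ≤ n + 1} ⊆ (N.biUnion T : Set W) := by
      rintro u ⟨w, hw⟩
      rw [Finset.mem_coe, Finset.mem_biUnion]
      cases w with
      | nil => exact ⟨v, by simp [N], by simpa [T] using ⟨Walk.nil, Nat.zero_le n⟩⟩
      | @cons _ a _ h w =>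
        rw [Walk.length_cons] at hw
        exact ⟨a, by simp [N, h], by simpa [T] using ⟨w, by omega⟩⟩
    have hN : N.card ≤ Δ := by
      rw [← Set.ncard_eq_toFinset_card]
      exact (Set.ncard_insert_le _ _).trans (hdeg v)
    calc _ ≤ (N.biUnion T : Set W).ncard := Set.ncard_le_ncard hsub
      _ = (N.biUnion T).card := Set.ncard_coe_finset _
      _ ≤ N.card * Δ ^ n := Finset.card_biUnion_le_card_mul _ _ _ fun a _ => by
          rw [← Set.ncard_eq_toFinset_card]
          exact ih a
      _ ≤ Δ * Δ ^ n := Nat.mul_le_mul_right _ hN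
      _ = Δ ^ (n + 1) := (pow_succ' _ _).symm

lemma ncard_component_le {W : Type*} [Finite W] {H : SimpleGraph W} {Δ q : ℕ}
    (hdeg : ∀ v, (H.neighborSet v).ncard + 1 ≤ Δ)
    (hpath : ∀ p : ℕ → W, Set.InjOn p (Set.Iio q) → ¬ ∀ i, i + 1 < q → H.Adj (p i) (p (i + 1)))
    (v : W) : (H.connectedComponentMk v).supp.ncard ≤ Δ ^ q := by
  refine (Set.ncard_le_ncard fun u hu => ?_).trans (ncard_walk_length_le hdeg q v)
  have hvu : H.Reachable v u := (ConnectedComponent.exact hu).symm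
  obtain ⟨w, hw⟩ := hvu.exists_isPath
  refine ⟨w, ?_⟩
  by_contra! hlen
  refine hpath w.getVert (hw.getVert_injOn.mono fun i hi => ?_) fun i hi => ?_
  · have hi : i < q := hi
    exact (hi.trans hlen).le
  · exact w.adj_getVert_succ (by omega)

theorem clusteredColourable_two [Finite V] {k : ℕ} (hk : 0 < k) (h1 : ¬ IsMinor (fan k) G)
    (h2 : ¬ IsMinor (fatPath k) G) (h3 : ¬ IsMinor (fatStar k) G) :
    ClusteredColourable G 2
      (((k + 2) * (k ^ k) ^ 2 + k ^ k) ^ ((2 * k ^ k + 1) * k)) := by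
  choose ρ hρ hdeg hpath using exists_layering hk h1 h2 h3
  let rep : V → V := fun v => (G.connectedComponentMk v).out
  have hrep : ∀ v, G.Reachable (rep v) v := fun v =>
    ConnectedComponent.exact (Quot.out_eq (G.connectedComponentMk v))
  have hrep_adj : ∀ u v, G.Adj u v → rep u = rep v := fun u v h =>
    congrArg Quot.out (ConnectedComponent.sound h.reachable)
  let f : V → Fin 2 := fun v => Fin.ofNat 2 (ρ (rep v) v)
  have hf : ∀ u v, G.Adj u v → f u = f v → ρ (rep u) v = ρ (rep u) u := by
    intro u v huv huv'
    have hr := hrep_adj u v huv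
    have h := congrArg Fin.val huv'
    have h4 := hρ _ u v (hrep u) huv
    have h5 := hρ _ v u (hrep v) huv.symm
    simp only [f, Fin.ofNat, ← hr] at h h5
    omega
  refine ⟨f, fun v => ncard_component_le (fun u => ?_) (fun p hinj hadj => ?_) _⟩
  · refine le_trans ?_ (hdeg _ u.1 (hrep u.1))
    refine Nat.succ_le_succ (Set.ncard_le_ncard_of_injOn Subtype.val (fun w hw => ?_)
      Subtype.val_injective.injOn)
    exact ⟨hw, hf u.1 w.1 hw (u.2.trans w.2.symm)⟩
  · have hconst : ∀ i < (2 * k ^ k + 1) * k, rep (p i).1 = rep (p 0).1 ∧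
        ρ (rep (p 0).1) (p i).1 = ρ (rep (p 0).1) (p 0).1 := by
      intro i
      induction i with
      | zero => exact fun _ => ⟨rfl, rfl⟩
      | succ i ih =>
        intro hi
        obtain ⟨h4, h5⟩ := ih (by omega)
        have hadj' : G.Adj (p i).1 (p (i + 1)).1 := hadj i hi
        have h6 := hf _ _ hadj' ((p i).2.trans (p (i + 1)).2.symm)
        rw [h4] at h6
        exact ⟨(hrep_adj _ _ hadj').symm.trans h4, h6.trans h5⟩
    refine hpath (rep (p 0).1) (fun i => (p i).1) (ρ (rep (p 0).1) (p 0).1) (fun i hi => ?_)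
      (fun a ha b hb hab => hinj ha hb (Subtype.ext hab)) hadj
    obtain ⟨h4, h5⟩ := hconst i hi
    exact ⟨h4 ▸ hrep (p i).1, h5⟩

lemma ClusteredColourable.mono {k c c' : ℕ} (h : ClusteredColourable G k c) (hc : c ≤ c') :
    ClusteredColourable G k c' :=
  h.imp fun _ hf v => (hf v).trans hc

lemma clustering_bound {k : ℕ} (hk : 2 ≤ k) :
    ((k + 2) * (k ^ k) ^ 2 + k ^ k) ^ ((2 * k ^ k + 1) * k) ≤
      k * ((k + 2) * k ^ k * (18 * k ^ (2 * k + 1) + 1)) ^ (k ^ (3 * (k + 2) * k ^ k)) := by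
  have hM : 0 < k ^ k := Nat.pow_pos (by omega)
  have hbase : (k + 2) * (k ^ k) ^ 2 + k ^ k ≤ (k + 2) * k ^ k * (18 * k ^ (2 * k + 1) + 1) := by
    have h1 : k ^ k ≤ k ^ (2 * k + 1) := Nat.pow_le_pow_right (by omega) (by omega)
    calc (k + 2) * (k ^ k) ^ 2 + k ^ k = ((k + 2) * k ^ k) * k ^ k + 1 * k ^ k := by ring
      _ ≤ ((k + 2) * k ^ k) * (18 * k ^ (2 * k + 1)) + (k + 2) * k ^ k :=
        Nat.add_le_add (Nat.mul_le_mul_left _ (by omega)) (Nat.mul_le_mul_right _ (by omega))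
      _ = _ := by ring
  have hexp : (2 * k ^ k + 1) * k ≤ k ^ (3 * (k + 2) * k ^ k) := by
    calc (2 * k ^ k + 1) * k ≤ (k ^ 2 * k ^ k) * k := by
          have h1 : 2 ^ 2 ≤ k ^ 2 := Nat.pow_le_pow_left hk 2
          have h2 := Nat.mul_le_mul_right (k ^ k) h1
          exact Nat.mul_le_mul_right _ (by omega)
      _ = k ^ (k + 3) := by ring
      _ ≤ _ := Nat.pow_le_pow_right (by omega) (by nlinarith)
  calc _ ≤ ((k + 2) * k ^ k * (18 * k ^ (2 * k + 1) + 1)) ^ ((2 * k ^ k + 1) * k) :=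
        Nat.pow_le_pow_left hbase _
    _ ≤ ((k + 2) * k ^ k * (18 * k ^ (2 * k + 1) + 1)) ^ (k ^ (3 * (k + 2) * k ^ k)) :=
        Nat.pow_le_pow_right (by positivity) hexp
    _ ≤ _ := Nat.le_mul_of_pos_left _ (by omega)

end ClusteredTwoColouring

/-- Let `k ≥ 2` and `d = (k+2)·k^k·(18·k^{2k+1} + 1)`.  Every graph with
no `k`-fan minor, no `k`-fat path minor, and no `k`-fat star minor is 2-colourable with
clustering `k·d^{k^{3(k+2)k^k}}`. -/
theorem two_colourable_no_fan_fatPath_fatStar (k : ℕ) (hk : 2 ≤ k)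
    (V : Type) [Finite V] (G : SimpleGraph V)
    (h1 : ¬ IsMinor (fan k) G) (h2 : ¬ IsMinor (fatPath k) G)
    (h3 : ¬ IsMinor (fatStar k) G) :
    ClusteredColourable G 2
      (k * ((k + 2) * k ^ k * (18 * k ^ (2 * k + 1) + 1)) ^ (k ^ (3 * (k + 2) * k ^ k))) := by
  exact ClusteredTwoColouring.ClusteredColourable.mono
    (ClusteredTwoColouring.clusteredColourable_two (by omega) h1 h2 h3)
    (ClusteredTwoColouring.clustering_bound hk)
end

section
/- Let k ≥ 2 be an integer. If a graph G contains a k(k+1)-strong H-model for some connected graph H with exactly k^k edges, then G contains the k-fat star or the k-fat path as a minor. -/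
open Finset in
/-- If every one of at most `n` sets has at least `n * m` elements, then one can choose `m` elements
from each of them, all distinct. -/
theorem exists_injective_prod_mem {E V : Type*} [Fintype E] [Finite V] {n m : ℕ}
    (hcard : Fintype.card E ≤ n) (S : E → Set V) (hS : ∀ e, n * m ≤ (S e).ncard) :
    ∃ f : E × Fin m → V, Function.Injective f ∧ ∀ q, f q ∈ S q.1 := by
  classical
  have := Fintype.ofFinite V
  obtain ⟨f, hf, hmem⟩ := (all_card_le_biUnion_card_iff_exists_injective
    (fun q : E × Fin m => (S q.1).toFinset)).1 fun s => by
      rcases s.eq_empty_or_nonempty with rfl | ⟨q, hq⟩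
      · simp
      · calc #s ≤ Fintype.card (E × Fin m) := card_le_univ s
          _ = Fintype.card E * m := by simp
          _ ≤ n * m := Nat.mul_le_mul_right m hcard
          _ ≤ (S q.1).ncard := hS q.1
          _ = #(S q.1).toFinset := Set.ncard_eq_toFinset_card' _
          _ ≤ _ := card_le_card (subset_biUnion_of_mem (fun q : E × Fin m => (S q.1).toFinset) hq)
  exact ⟨f, hf, fun q => by simpa using hmem q⟩

/-- Adding to a connected set vertices having a neighbour in it keeps it connected. -/
theorem SimpleGraph.Connected.induce_union_of_forall_adj {V : Type*} {G : SimpleGraph V}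
    {s t : Set V} (hs : (G.induce s).Connected) (ht : ∀ v ∈ t, ∃ x ∈ s, G.Adj v x) :
    (G.induce (s ∪ t)).Connected := by
  obtain ⟨u, hu⟩ := hs.nonempty
  refine G.induce_connected_of_patches u (Or.inl hu) fun {v} hv => ?_
  rcases hv with hv | hv
  · exact ⟨s, Set.subset_union_left, hu, hv, hs.preconnected _ _⟩
  · obtain ⟨x, hx, hadj⟩ := ht v hv
    have hv' : (G.induce {v}).Preconnected := by
      rintro ⟨a, rfl⟩ ⟨b, rfl⟩
      rfl
    exact ⟨s ∪ {v}, Set.union_subset_union_right s (by simpa using hv), Or.inl hu, Or.inr rfl,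
      (SimpleGraph.connected_induce_union hs.preconnected hv' hx rfl hadj.symm).preconnected _ _⟩

/-- From a `k(k+1)`-strong `H`-model and a family of at most `k` edges of `H`, one obtains a model
in which the branch sets at the ends of each of these edges are adjacent and have `k` private
common neighbours. -/
theorem StrongModel.exists_fat_edges {V A E : Type*} [Finite V] [Fintype E] {G : SimpleGraph V}
    {H : SimpleGraph A} {k : ℕ} (hmodel : StrongModel (k * (k + 1)) H G)
    (hcard : Fintype.card E ≤ k) (src dst : E → A) (hadj : ∀ e, H.Adj (src e) (dst e)) :
    ∃ (Y : A → Set V) (f : E × Fin k → V),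
      (∀ a, (G.induce (Y a)).Connected) ∧ (Pairwise fun a b => Disjoint (Y a) (Y b)) ∧
      Function.Injective f ∧ (∀ a q, f q ∉ Y a) ∧
      (∀ e, ∃ x ∈ Y (src e), ∃ y ∈ Y (dst e), G.Adj x y) ∧
      (∀ q, ∃ x ∈ Y (src q.1), G.Adj x (f q)) ∧
      (∀ q, ∃ x ∈ Y (dst q.1), G.Adj x (f q)) := by
  obtain ⟨X, hconn, hdisj, hX⟩ := hmodel
  obtain ⟨g, hg, hmem⟩ := exists_injective_prod_mem hcard _ fun e => hX _ _ (hadj e)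
  have hout : ∀ q a, g q ∉ X a := fun q => (hmem q).1
  refine ⟨fun a => X a ∪ {v | ∃ e, src e = a ∧ v = g (e, Fin.last k)},
    fun q => g (q.1, q.2.castSucc), fun a => ?_, fun a b hab => ?_, fun q r h => ?_,
    fun a q => ?_, fun e => ?_, fun q => ?_, fun q => ?_⟩
  · refine (hconn a).induce_union_of_forall_adj ?_
    rintro v ⟨e, rfl, rfl⟩
    exact (hmem (e, Fin.last k)).2.1
  · refine Set.disjoint_left.2 ?_
    rintro v (hv | ⟨e, rfl, rfl⟩) (hw | ⟨e', rfl, h⟩)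
    · exact Set.disjoint_left.1 (hdisj hab) hv hw
    · exact hout _ _ (h ▸ hv)
    · exact hout _ _ hw
    · exact hab (congrArg src (Prod.ext_iff.1 (hg h)).1)
  · have := Prod.ext_iff.1 (hg h)
    exact Prod.ext this.1 (Fin.castSucc_injective k this.2)
  · rintro (h | ⟨e, -, h⟩)
    · exact hout _ _ h
    · exact (Fin.castSucc_lt_last q.2).ne (Prod.ext_iff.1 (hg h)).2
  · obtain ⟨y, hy, h⟩ := (hmem (e, Fin.last k)).2.2
    exact ⟨_, Or.inr ⟨e, rfl, rfl⟩, y, Or.inl hy, h⟩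
  · obtain ⟨x, hx, h⟩ := (hmem (q.1, q.2.castSucc)).2.1
    exact ⟨x, Or.inl hx, h.symm⟩
  · obtain ⟨x, hx, h⟩ := (hmem (q.1, q.2.castSucc)).2.2
    exact ⟨x, Or.inl hx, h.symm⟩

/-- A family of branch sets, reindexed injectively, together with distinct singletons avoiding all
of them, is a family of pairwise disjoint connected sets; so only adjacencies remain to be checked
for it to exhibit a minor. -/
theorem isMinor_of_branchSets_of_singletons {V A B Q : Type*} {G : SimpleGraph V}
    {F : SimpleGraph (B ⊕ Q)} {Y : A → Set V} {f : Q → V} {p : B → A}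
    (hconn : ∀ a, (G.induce (Y a)).Connected) (hdisj : Pairwise fun a b => Disjoint (Y a) (Y b))
    (hf : Function.Injective f) (hfY : ∀ a q, f q ∉ Y a) (hp : Function.Injective p)
    (hadj : ∀ a b, F.Adj a b →
      ∃ x ∈ Sum.elim (fun b => Y (p b)) (fun q => {f q}) a,
      ∃ y ∈ Sum.elim (fun b => Y (p b)) (fun q => {f q}) b, G.Adj x y) :
    IsMinor F G := by
  refine ⟨_, ?_, ?_, hadj⟩
  · rintro (b | q)
    · exact hconn _
    · refine (SimpleGraph.connected_iff _).2 ⟨?_, ⟨f q, rfl⟩⟩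
      rintro ⟨a, rfl⟩ ⟨b, rfl⟩
      rfl
  · rintro (b | q) (b' | q') hne
    · exact hdisj (hp.ne fun h => hne (h ▸ rfl))
    · exact Set.disjoint_singleton_right.2 (hfY _ _)
    · exact Set.disjoint_singleton_left.2 (hfY _ _)
    · exact Set.disjoint_singleton.2 (hf.ne fun h => hne (h ▸ rfl))

/-- A minor of `G` transported along an isomorphism. -/
theorem IsMinor.congr {V B C : Type*} {G : SimpleGraph V} {F : SimpleGraph B} {F' : SimpleGraph C}
    (e : F' ≃g F) (h : IsMinor F G) : IsMinor F' G := by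
  obtain ⟨X, hconn, hdisj, hadj⟩ := h
  exact ⟨X ∘ e, fun a => hconn _, fun a b hab => hdisj (e.injective.ne hab),
    fun a b hab => hadj _ _ (e.map_rel_iff.2 hab)⟩

/-- A strong model of a graph with a vertex of degree at least `k` yields a `k`-fat star. -/
theorem StrongModel.isMinor_fatStar {V A : Type*} [Finite V] {G : SimpleGraph V}
    {H : SimpleGraph A} {k : ℕ} (hmodel : StrongModel (k * (k + 1)) H G) (v : A)
    (w : Fin k → A) (hw : Function.Injective w) (hadj : ∀ i, H.Adj v (w i)) :
    IsMinor (fatStar k) G := by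
  obtain ⟨Y, f, hconn, hdisj, hf, hfY, he, hsrc, hdst⟩ :=
    hmodel.exists_fat_edges (E := Fin k) (by simp) (fun _ => v) w hadj
  let c := Equiv.sumAssoc Unit (Fin k) (Fin k × Fin k)
  refine IsMinor.congr (SimpleGraph.Iso.comap c (fatStar k)).symm
    (isMinor_of_branchSets_of_singletons (p := Sum.elim (fun _ => v) w) hconn hdisj hf hfY
      ?_ ?_)
  · rintro (_ | i) (_ | j) h
    · rfl
    · exact ((hadj j).ne h).elim
    · exact ((hadj i).ne h.symm).elim
    · exact congrArg _ (hw h)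
  · have key : ∀ a b : (Unit ⊕ Fin k) ⊕ Fin k × Fin k, (match c a, c b with
        | Sum.inl _, Sum.inr _ => True
        | Sum.inr (Sum.inl i), Sum.inr (Sum.inr (i', _)) => i = i'
        | _, _ => False) →
        ∃ x ∈ Sum.elim (fun b => Y (Sum.elim (fun _ => v) w b)) (fun q => {f q}) a,
        ∃ y ∈ Sum.elim (fun b => Y (Sum.elim (fun _ => v) w b)) (fun q => {f q}) b,
          G.Adj x y := by
      rintro ((_ | i) | ⟨i, j⟩) ((_ | i') | ⟨i', j'⟩) h
      · exact h.elim
      · exact he i'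
      · obtain ⟨x, hx, h⟩ := hsrc (i', j')
        exact ⟨x, hx, _, rfl, h⟩
      · exact h.elim
      · exact h.elim
      · obtain rfl : i = i' := h
        obtain ⟨x, hx, h⟩ := hdst (i, j')
        exact ⟨x, hx, _, rfl, h⟩
      · exact h.elim
      · exact h.elim
      · exact h.elim
    rintro a b ⟨-, h | h⟩
    · exact key a b h
    · obtain ⟨x, hx, y, hy, hxy⟩ := key b a h
      exact ⟨y, hy, x, hx, hxy.symm⟩

/-- A strong model of a graph with a path on `k` vertices yields a `k`-fat path. -/
theorem StrongModel.isMinor_fatPath {V A : Type*} [Finite V] {G : SimpleGraph V}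
    {H : SimpleGraph A} {k : ℕ} (hmodel : StrongModel (k * (k + 1)) H G)
    (p : Fin k → A) (hp : Function.Injective p)
    (hadj : ∀ i j : Fin k, (i : ℕ) + 1 = j → H.Adj (p i) (p j)) :
    IsMinor (fatPath k) G := by
  obtain ⟨Y, f, hconn, hdisj, hf, hfY, he, hsrc, hdst⟩ :=
    hmodel.exists_fat_edges (E := Fin (k - 1)) (by simp) (fun i => p ⟨i, by omega⟩)
      (fun i => p ⟨i + 1, by omega⟩) (fun i => hadj _ _ rfl)
  refine isMinor_of_branchSets_of_singletons hconn hdisj hf hfY hp ?_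
  have key : ∀ a b : Fin k ⊕ Fin (k - 1) × Fin k, (match a, b with
      | Sum.inl i, Sum.inl j => (i : ℕ) + 1 = (j : ℕ)
      | Sum.inl i, Sum.inr (e, _) => (i : ℕ) = (e : ℕ) ∨ (i : ℕ) = (e : ℕ) + 1
      | _, _ => False) →
      ∃ x ∈ Sum.elim (fun b => Y (p b)) (fun q => {f q}) a,
      ∃ y ∈ Sum.elim (fun b => Y (p b)) (fun q => {f q}) b, G.Adj x y := by
    rintro (⟨i, hi⟩ | ⟨i, j⟩) (⟨i', hi'⟩ | ⟨i', j'⟩) h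
    · obtain rfl : i + 1 = i' := h
      exact he ⟨i, by omega⟩
    · rcases h with h | h
      · obtain rfl : i = i' := h
        obtain ⟨x, hx, h⟩ := hsrc (i', j')
        exact ⟨x, hx, _, rfl, h⟩
      · obtain rfl : i = i' + 1 := h
        obtain ⟨x, hx, h⟩ := hdst (i', j')
        exact ⟨x, hx, _, rfl, h⟩
    · exact h.elim
    · exact h.elim
  rintro a b ⟨-, h | h⟩
  · exact key a b h
  · obtain ⟨x, hx, y, hy, hxy⟩ := key b a h
    exact ⟨y, hy, x, hx, hxy.symm⟩

open Finset in
/-- In a connected graph with all degrees less than `k`, a ball of radius `d` has at most `k ^ d`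
vertices. -/
theorem SimpleGraph.Connected.card_dist_le_le_pow {A : Type*} [Fintype A] {H : SimpleGraph A}
    [DecidableRel H.Adj] (hH : H.Connected) {k : ℕ} (hdeg : ∀ v, H.degree v < k) (r : A) (d : ℕ) :
    #{v | H.dist r v ≤ d} ≤ k ^ d := by
  classical
  induction d with
  | zero => simp [hH.dist_eq_zero_iff, filter_eq]
  | succ d ih =>
    have hsub : ({v | H.dist r v ≤ d + 1} : Finset A) ⊆
        ({v | H.dist r v ≤ d} : Finset A).biUnion fun u => insert u (H.neighborFinset u) := by
      intro v hv
      simp only [mem_filter, mem_univ, true_and, mem_biUnion, mem_insert,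
        mem_neighborFinset] at hv ⊢
      rcases hv.lt_or_eq with hlt | heq
      · exact ⟨v, by omega, Or.inl rfl⟩
      · obtain ⟨w, hw⟩ := hH.exists_walk_length_eq_dist r v
        refine ⟨w.penultimate, (H.dist_le w.dropLast).trans ?_,
          Or.inr (w.adj_penultimate (by rw [Walk.not_nil_iff_lt_length]; omega))⟩
        simp [hw, heq]
    calc #{v | H.dist r v ≤ d + 1} ≤ _ := card_le_card hsub
      _ ≤ #{v | H.dist r v ≤ d} * k := card_biUnion_le_card_mul _ _ _ fun u _ =>
          (card_insert_le _ _).trans (by rw [card_neighborFinset_eq_degree]; exact hdeg u)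
      _ ≤ k ^ d * k := Nat.mul_le_mul_right k ih
      _ = k ^ (d + 1) := (pow_succ k d).symm

open Finset in
/-- A connected graph with `k ^ k` edges and all degrees less than `k` has two vertices at distance
at least `k - 1`. -/
theorem SimpleGraph.Connected.exists_le_dist {A : Type*} [Fintype A] {H : SimpleGraph A}
    [DecidableRel H.Adj] (hH : H.Connected) {k : ℕ} (hk : 2 ≤ k) (hE : #H.edgeFinset = k ^ k)
    (hdeg : ∀ v, H.degree v < k) : ∃ u v, k - 1 ≤ H.dist u v := by
  obtain ⟨r⟩ := hH.nonempty
  by_contra! hdist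
  have hcard : Fintype.card A ≤ k ^ (k - 1) := by
    have := hH.card_dist_le_le_pow hdeg r (k - 1)
    rwa [filter_true_of_mem fun v _ => (hdist r v).le] at this
  have hsum : 2 * k ^ k ≤ k ^ k := calc
    2 * k ^ k = ∑ v, H.degree v := by rw [H.sum_degrees_eq_twice_card_edges, hE]
    _ ≤ Fintype.card A * k := sum_le_card_nsmul univ _ k fun v _ => (hdeg v).le
    _ ≤ k ^ (k - 1) * k := Nat.mul_le_mul_right k hcard
    _ = k ^ k := pow_sub_one_mul (by omega) k
  have : 0 < k ^ k := by positivity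
  omega

/-- For `k ≥ 2`, if a graph `G` contains a `k(k+1)`-strong `H`-model for
some connected graph `H` with exactly `k^k` edges, then `G` contains the `k`-fat star or
the `k`-fat path as a minor. -/
theorem strongModel_to_fatStar_or_fatPath (k : ℕ) (hk : 2 ≤ k)
    (V : Type) [Finite V] (G : SimpleGraph V)
    (A : Type) [Finite A] (H : SimpleGraph A)
    (hH : H.Connected) (hE : H.edgeSet.ncard = k ^ k)
    (hmodel : StrongModel (k * (k + 1)) H G) :
    IsMinor (fatStar k) G ∨ IsMinor (fatPath k) G := by
  classical
  have := Fintype.ofFinite A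
  by_cases hdeg : ∀ v, H.degree v < k
  · right
    have hE' : H.edgeFinset.card = k ^ k := by rw [← hE, Set.ncard_eq_toFinset_card']; rfl
    obtain ⟨u, v, huv⟩ := hH.exists_le_dist hk hE' hdeg
    obtain ⟨w, hw, hlen⟩ := hH.exists_path_of_dist u v
    refine hmodel.isMinor_fatPath (fun i => w.getVert i) (fun i j h => ?_) fun i j h => ?_
    · exact Fin.ext (hw.getVert_injOn (show (i : ℕ) ≤ w.length by omega)
        (show (j : ℕ) ≤ w.length by omega) h)
    · simpa only [← h] using w.adj_getVert_succ (i := i) (by omega)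
  · left
    push Not at hdeg
    obtain ⟨v, hv⟩ := hdeg
    rw [← H.card_neighborSet_eq_degree] at hv
    obtain ⟨φ⟩ : Nonempty (Fin k ↪ H.neighborSet v) :=
      Function.Embedding.nonempty_of_card_le (by simpa using hv)
    exact hmodel.isMinor_fatStar v (fun i => φ i)
      (fun i j h => φ.injective (Subtype.ext h)) fun i => (φ i).2
end

section
/- Let k ≥ 1 and c ≥ 1 be integers. If a connected graph G contains a (k + 2c − 2)-strong H-model for some graph H with exactly c connected components, then G contains a k-strong H′-model for some connected graph H′ with |E(H′)| = |E(H)|. -/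
open SimpleGraph

section Identify

variable {A : Type*} {H : SimpleGraph A} {a b : A}

open Classical in
/-- The map identifying the vertex `b` with the vertex `a`. -/
noncomputable def identifyVertex (hab : a ≠ b) (v : A) : {v : A // v ≠ b} :=
  if h : v = b then ⟨a, hab⟩ else ⟨v, h⟩

lemma identifyVertex_self (hab : a ≠ b) : identifyVertex hab b = ⟨a, hab⟩ := by
  simp [identifyVertex]

lemma identifyVertex_of_ne (hab : a ≠ b) {v : A} (hv : v ≠ b) :
    identifyVertex hab v = ⟨v, hv⟩ := by
  simp [identifyVertex, hv]

lemma identifyVertex_surjective (hab : a ≠ b) : Function.Surjective (identifyVertex hab) :=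
  fun v => ⟨v.1, identifyVertex_of_ne hab v.2⟩

lemma eq_or_of_identifyVertex_eq (hab : a ≠ b) {u v : A}
    (h : identifyVertex hab u = identifyVertex hab v) :
    u = v ∨ (u = a ∧ v = b) ∨ (u = b ∧ v = a) := by
  unfold identifyVertex at h
  split_ifs at h <;> simp_all

lemma identifyVertex_ne_of_adj (hab : a ≠ b) (hr : ¬ H.Reachable a b) {u v : A}
    (huv : H.Adj u v) : identifyVertex hab u ≠ identifyVertex hab v := by
  intro h
  rcases eq_or_of_identifyVertex_eq hab h with rfl | ⟨rfl, rfl⟩ | ⟨rfl, rfl⟩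
  · exact H.irrefl huv
  · exact hr huv.reachable
  · exact hr huv.symm.reachable

/-- Identifying two vertices in distinct components merges no two edges. -/
lemma ncard_edgeSet_map_identifyVertex (hab : a ≠ b) (hr : ¬ H.Reachable a b) :
    (H.map (identifyVertex hab)).edgeSet.ncard = H.edgeSet.ncard := by
  have himage : (H.map (identifyVertex hab)).edgeSet =
      Sym2.map (identifyVertex hab) '' H.edgeSet := by
    ext e
    induction e with | _ x y
    constructor
    · rintro ⟨-, u, v, huv, rfl, rfl⟩
      exact ⟨s(u, v), huv, rfl⟩
    · rintro ⟨e, he, h⟩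
      induction e with | _ u v
      rw [← h]
      exact ⟨identifyVertex_ne_of_adj hab hr he, u, v, he, rfl, rfl⟩
  have key : ∀ u v u' v', H.Adj u v → H.Adj u' v' →
      identifyVertex hab u = identifyVertex hab u' →
      identifyVertex hab v = identifyVertex hab v' → u = u' ∧ v = v' := by
    intro u v u' v' huv huv' h₁ h₂
    have r₁ := huv.reachable
    have r₂ := huv'.reachable
    rcases eq_or_of_identifyVertex_eq hab h₁ with rfl | ⟨rfl, rfl⟩ | ⟨rfl, rfl⟩ <;>
      rcases eq_or_of_identifyVertex_eq hab h₂ with rfl | ⟨rfl, rfl⟩ | ⟨rfl, rfl⟩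
    · exact ⟨rfl, rfl⟩
    · exact absurd (r₁.symm.trans r₂) hr
    · exact absurd (r₂.symm.trans r₁) hr
    · exact absurd (r₁.trans r₂.symm) hr
    · exact absurd huv (H.irrefl)
    · exact absurd r₁ hr
    · exact absurd (r₂.trans r₁.symm) hr
    · exact absurd r₂ hr
    · exact absurd huv (H.irrefl)
  rw [himage]
  refine Set.InjOn.ncard_image ?_
  intro e he e' he' h
  induction e with | _ u v
  induction e' with | _ u' v'
  rcases Sym2.eq_iff.1 h with ⟨h₁, h₂⟩ | ⟨h₁, h₂⟩
  · obtain ⟨rfl, rfl⟩ := key u v u' v' he he' h₁ h₂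
    rfl
  · obtain ⟨rfl, rfl⟩ := key u v v' u' he (Adj.symm he') h₁ h₂
    exact Sym2.eq_swap

/-- Identifying two vertices in distinct components decreases the number of components. -/
lemma card_connectedComponent_map_identifyVertex_lt [Finite A] (hab : a ≠ b)
    (hr : ¬ H.Reachable a b) :
    Nat.card (H.map (identifyVertex hab)).ConnectedComponent <
      Nat.card H.ConnectedComponent := by
  let φ : H →g H.map (identifyVertex hab) :=
    Hom.map _ H (identifyVertex_ne_of_adj hab hr)
  have hsurj : Function.Surjective (ConnectedComponent.map φ) := by
    intro C
    induction C using ConnectedComponent.ind with | _ v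
    obtain ⟨u, rfl⟩ := identifyVertex_surjective hab v
    exact ⟨H.connectedComponentMk u, rfl⟩
  have hninj : ¬ Function.Injective (ConnectedComponent.map φ) := by
    intro hinj
    refine hr (ConnectedComponent.exact (hinj (?_ :
      (H.map (identifyVertex hab)).connectedComponentMk (identifyVertex hab a) =
        (H.map (identifyVertex hab)).connectedComponentMk (identifyVertex hab b))))
    rw [identifyVertex_self, identifyVertex_of_ne]
  have := Fintype.ofFinite H.ConnectedComponent
  have := Fintype.ofFinite (H.map (identifyVertex hab)).ConnectedComponent
  rw [Nat.card_eq_fintype_card, Nat.card_eq_fintype_card]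
  exact Fintype.card_lt_of_surjective_not_injective _ hsurj hninj

end Identify

section ShortestLink

variable {V A : Type*} {G : SimpleGraph V} {H : SimpleGraph A} {X : A → Set V}

/-- A shortest walk among those joining sets of `X` indexed by different components of `H`. -/
lemma exists_shortest_link (hG : G.Connected) (hX : ∀ a, (X a).Nonempty)
    (hH : ¬ H.Preconnected) :
    ∃ a b x y, x ∈ X a ∧ y ∈ X b ∧ ¬ H.Reachable a b ∧ ∃ p : G.Walk x y,
      ∀ a' b' x' y', x' ∈ X a' → y' ∈ X b' → ¬ H.Reachable a' b' →
        ∀ q : G.Walk x' y', p.length ≤ q.length := by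
  classical
  let P : ℕ → Prop := fun n => ∃ a b x y, x ∈ X a ∧ y ∈ X b ∧ ¬ H.Reachable a b ∧
    ∃ p : G.Walk x y, p.length = n
  have hP : ∃ n, P n := by
    simp only [Preconnected, not_forall] at hH
    obtain ⟨a, b, hab⟩ := hH
    obtain ⟨x, hx⟩ := hX a
    obtain ⟨y, hy⟩ := hX b
    obtain ⟨p⟩ := hG x y
    exact ⟨p.length, a, b, x, y, hx, hy, hab, p, rfl⟩
  obtain ⟨a, b, x, y, hx, hy, hab, p, hp⟩ := Nat.find_spec hP
  refine ⟨a, b, x, y, hx, hy, hab, p, fun a' b' x' y' hx' hy' hab' q => ?_⟩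
  rw [hp]
  exact Nat.find_min' hP ⟨a', b', x', y', hx', hy', hab', q, rfl⟩

variable {a b : A} {x y : V} {p : G.Walk x y}

/-- A shortest link only meets the sets that it joins. -/
lemma mem_of_mem_shortest_link (hx : x ∈ X a) (hy : y ∈ X b) (hab : ¬ H.Reachable a b)
    (hp : ∀ a' b' x' y', x' ∈ X a' → y' ∈ X b' → ¬ H.Reachable a' b' →
      ∀ q : G.Walk x' y', p.length ≤ q.length)
    {w : V} (hw : w ∈ p.support) {u : A} (hu : w ∈ X u) : w ∈ X a ∨ w ∈ X b := by
  obtain ⟨i, rfl, hi⟩ := Walk.mem_support_iff_exists_getVert.1 hw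
  by_cases hau : H.Reachable a u
  · have hub : ¬ H.Reachable u b := fun h => hab (hau.trans h)
    have h := hp _ _ _ _ hu hy hub (p.drop i)
    rw [Walk.drop_length] at h
    obtain rfl | h' : i = 0 ∨ i = p.length := by omega
    · exact .inl (by simpa using hx)
    · exact .inr (by simpa [h'] using hy)
  · have h := hp _ _ _ _ hx hu hau (p.take i)
    rw [Walk.take_length] at h
    have h' : i = p.length := by omega
    exact .inr (by simpa [h'] using hy)

/-- Apart from its ends, at most the second and the penultimate vertex of a shortest link
have neighbours in the sets of `X`. -/
lemma eq_of_mem_shortest_link_of_adj (hx : x ∈ X a) (hy : y ∈ X b)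
    (hab : ¬ H.Reachable a b)
    (hp : ∀ a' b' x' y', x' ∈ X a' → y' ∈ X b' → ¬ H.Reachable a' b' →
      ∀ q : G.Walk x' y', p.length ≤ q.length)
    {w : V} (hw : w ∈ p.support) (hwX : ∀ u, w ∉ X u) {u : A} {z : V} (hz : z ∈ X u)
    (hwz : G.Adj w z) : w = p.getVert 1 ∨ w = p.getVert (p.length - 1) := by
  obtain ⟨i, rfl, hi⟩ := Walk.mem_support_iff_exists_getVert.1 hw
  have h0 : i ≠ 0 := by
    rintro rfl
    exact hwX a (by simpa using hx)
  have hl : i ≠ p.length := by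
    intro h
    exact hwX b (by simpa [h] using hy)
  by_cases hau : H.Reachable a u
  · have hub : ¬ H.Reachable u b := fun h => hab (hau.trans h)
    have h := hp _ _ _ _ hz hy hub (Walk.cons hwz.symm (p.drop i))
    rw [Walk.length_cons, Walk.drop_length] at h
    obtain rfl : i = 1 := by omega
    exact .inl rfl
  · have h := hp _ _ _ _ hx hz hau ((p.take i).concat hwz)
    rw [Walk.length_concat, Walk.take_length] at h
    obtain rfl : i = p.length - 1 := by omega
    exact .inr rfl

end ShortestLink

section StrongModel

variable {V A : Type*} {G : SimpleGraph V} {H : SimpleGraph A}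

lemma StrongModel.mono {k l : ℕ} (hkl : k ≤ l) (h : StrongModel l H G) :
    StrongModel k H G := by
  obtain ⟨X, hconn, hdisj, hX⟩ := h
  exact ⟨X, hconn, hdisj, fun a b hab => hkl.trans (hX a b hab)⟩

/-- Merging the branch sets of two vertices in distinct components along a shortest link
loses at most two common neighbours per edge. -/
lemma StrongModel.exists_identifyVertex [Finite V] (hG : G.Connected) (hH : ¬ H.Preconnected)
    {m : ℕ} (h : StrongModel (m + 2) H G) :
    ∃ (a b : A) (hab : a ≠ b), ¬ H.Reachable a b ∧
      StrongModel m (H.map (identifyVertex hab)) G := by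
  classical
  obtain ⟨X, hconn, hdisj, hX⟩ := h
  have hne : ∀ a, (X a).Nonempty := fun a => Set.nonempty_coe_sort.1 (hconn a).nonempty
  obtain ⟨a, b, x, y, hx, hy, hr, p, hp⟩ := exists_shortest_link hG hne hH
  have hab : a ≠ b := by
    rintro rfl
    exact hr (Reachable.refl _)
  have hmem {w : V} (hw : w ∈ p.support) {u : A} (hu : w ∈ X u) :=
    mem_of_mem_shortest_link hx hy hr hp hw hu
  let Y : Set V := (X a ∪ {v | v ∈ p.support}) ∪ X b
  let X' : {v : A // v ≠ b} → Set V := fun v => if v.1 = a then Y else X v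
  have hYconn : (G.induce Y).Connected := by
    refine induce_union_connected (induce_union_connected (hconn a).preconnected
      p.connected_induce_support.preconnected ⟨x, hx, p.start_mem_support⟩).preconnected
      (hconn b).preconnected ⟨y, .inr p.end_mem_support, hy⟩
  have hYdisj {u : A} (hua : u ≠ a) (hub : u ≠ b) : Disjoint Y (X u) := by
    rw [Set.disjoint_left]
    intro w hw hwu
    have hw' : w ∈ X a ∨ w ∈ X b := by
      rcases hw with (hw | hw) | hw
      · exact .inl hw
      · exact hmem hw hwu
      · exact .inr hw
    rcases hw' with hw | hw
    · exact Set.disjoint_left.1 (hdisj hua) hwu hw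
    · exact Set.disjoint_left.1 (hdisj hub) hwu hw
  have hsub (u : A) : X u ⊆ X' (identifyVertex hab u) := by
    intro w hw
    by_cases hub : u = b
    · subst hub
      rw [identifyVertex_self]
      simp [X', Y, hw]
    · rw [identifyVertex_of_ne hab hub]
      by_cases hua : u = a
      · subst hua
        simp [X', Y, hw]
      · simpa [X', hua] using hw
  have hcover {v : {v : A // v ≠ b}} {w : V} (hw : w ∈ X' v) (hwX : ∀ u, w ∉ X u) :
      w ∈ p.support := by
    by_cases hva : v.1 = a
    · simp only [X', hva, if_true] at hw
      rcases hw with (hw | hw) | hw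
      · exact absurd hw (hwX a)
      · exact hw
      · exact absurd hw (hwX b)
    · simp only [X', hva, if_false] at hw
      exact absurd hw (hwX v)
  refine ⟨a, b, hab, hr, X', fun v => ?_, fun u v huv => ?_, ?_⟩
  · by_cases hva : v.1 = a
    · rwa [show X' v = Y from if_pos hva]
    · rw [show X' v = X v from if_neg hva]
      exact hconn v
  · have huv' : u.1 ≠ v.1 := fun h => huv (Subtype.ext h)
    by_cases hua : u.1 = a
    · have hva : v.1 ≠ a := fun h => huv' (hua.trans h.symm)
      simpa only [X', hua, hva, if_true, if_false] using hYdisj hva v.2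
    · by_cases hva : v.1 = a
      · simpa only [X', hua, hva, if_true, if_false] using (hYdisj hua u.2).symm
      · simpa only [X', hua, hva, if_false] using hdisj huv'
  · rintro _ _ ⟨-, u, v, huv, rfl, rfl⟩
    have hle := (hX u v huv).trans (Set.ncard_le_ncard
      (t := {w : V | (∀ z, w ∉ X' z) ∧ (∃ z ∈ X' (identifyVertex hab u), G.Adj w z) ∧
        (∃ z ∈ X' (identifyVertex hab v), G.Adj w z)} ∪
        {p.getVert 1, p.getVert (p.length - 1)}) ?_ (Set.toFinite _))
    · have h₁ := hle.trans (Set.ncard_union_le _ _)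
      have h₂ := Set.ncard_insert_le (p.getVert 1) {p.getVert (p.length - 1)}
      rw [Set.ncard_singleton] at h₂
      omega
    · rintro w ⟨hwX, ⟨s, hs, hws⟩, ⟨t, ht, hwt⟩⟩
      by_cases hw : w ∈ p.support
      · exact .inr (eq_of_mem_shortest_link_of_adj hx hy hr hp hw hwX hs hws)
      · exact .inl ⟨fun z hz => hw (hcover hz hwX), ⟨s, hsub u hs, hws⟩, ⟨t, hsub v ht, hwt⟩⟩

end StrongModel

/-- A graph with at most `n + 1` components becomes connected after at most `n` merges. -/
lemma StrongModel.exists_connected.{u, v} {V : Type v} [Finite V] {G : SimpleGraph V}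
    (hG : G.Connected) (k n : ℕ) {A : Type u} [Finite A] [Nonempty A] (H : SimpleGraph A)
    (hcomp : Nat.card H.ConnectedComponent ≤ n + 1) (hmodel : StrongModel (k + 2 * n) H G) :
    ∃ (B : Type u) (_ : Finite B) (H' : SimpleGraph B),
      H'.Connected ∧ H'.edgeSet.ncard = H.edgeSet.ncard ∧ StrongModel k H' G := by
  induction n generalizing A with
  | zero =>
    have : Subsingleton H.ConnectedComponent := Finite.card_le_one_iff_subsingleton.1 hcomp
    refine ⟨A, ‹_›, H, ⟨fun u v => ?_⟩, rfl, hmodel⟩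
    exact ConnectedComponent.exact (Subsingleton.elim _ _)
  | succ n ih =>
    by_cases hH : H.Preconnected
    · exact ⟨A, ‹_›, H, ⟨hH⟩, rfl, hmodel.mono (by omega)⟩
    · obtain ⟨a, b, hab, hr, hmodel'⟩ :=
        StrongModel.exists_identifyVertex (m := k + 2 * n) hG hH hmodel
      have hlt := card_connectedComponent_map_identifyVertex_lt hab hr
      have : Nonempty {v : A // v ≠ b} := ⟨⟨a, hab⟩⟩
      obtain ⟨B, hB, H', hconn, hcard, hmodel''⟩ :=
        ih (H.map (identifyVertex hab)) (by omega) hmodel'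
      exact ⟨B, hB, H', hconn, hcard.trans (ncard_edgeSet_map_identifyVertex hab hr), hmodel''⟩

/-- For `k, c ≥ 1`, if a connected graph `G` contains a
`(k + 2c - 2)`-strong `H`-model for some graph `H` with exactly `c` connected components,
then `G` contains a `k`-strong `H'`-model for some connected graph `H'` with the same
number of edges as `H`. -/
theorem strongModel_make_connected (k c : ℕ) (hk : 1 ≤ k) (hc : 1 ≤ c)
    (V : Type) [Finite V] (G : SimpleGraph V) (hG : G.Connected)
    (A : Type) [Finite A] (H : SimpleGraph A)
    (hcomp : Nat.card H.ConnectedComponent = c)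
    (hmodel : StrongModel (k + 2 * c - 2) H G) :
    ∃ (B : Type) (_ : Finite B) (H' : SimpleGraph B),
      H'.Connected ∧ H'.edgeSet.ncard = H.edgeSet.ncard ∧
      StrongModel k H' G := by
  have : Nonempty A := by
    have : Nonempty H.ConnectedComponent := (Nat.card_pos_iff.1 (by omega)).1
    exact this.elim fun C => ⟨C.nonempty_supp.some⟩
  refine StrongModel.exists_connected hG k (c - 1) H (by omega) ?_
  exact hmodel.mono (by omega)
end

section
/- Let k ≥ 2 and ℓ ≥ 1 be integers, and let G be a connected graph with a vertex v such that v is not a cut-vertex of G and v has degree at least 2ℓk in G. Then G contains the k-fan as a minor, or there is a connected subgraph X of G − v and a set of ℓ neighbours of v, none of which lies in X, each of which is adjacent to a vertex of X (so that contracting X yields a K_{2,ℓ} minor). -/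
/-- A vertex set is connected if every vertex other than a root `r` has a neighbour in the set
of smaller height. -/
lemma SimpleGraph.induce_connected_of_height {V : Type*} (G : SimpleGraph V) (h : V → ℕ)
    {X : Set V} {r : V} (hr : r ∈ X)
    (hX : ∀ x ∈ X, x ≠ r → ∃ y ∈ X, G.Adj x y ∧ h y < h x) : (G.induce X).Connected := by
  have key : ∀ n, ∀ x (hx : x ∈ X), h x = n → (G.induce X).Reachable ⟨x, hx⟩ ⟨r, hr⟩ := by
    intro n
    induction n using Nat.strong_induction_on with
    | _ n ih =>
      intro x hx hn
      by_cases hxr : x = r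
      · subst hxr
        exact Reachable.refl _
      · obtain ⟨y, hy, hadj, hlt⟩ := hX x hx hxr
        have hadj' : (G.induce X).Adj ⟨x, hx⟩ ⟨y, hy⟩ := hadj
        exact hadj'.reachable.trans (ih (h y) (hn ▸ hlt) y hy rfl)
  have : Nonempty X := ⟨⟨r, hr⟩⟩
  exact ⟨fun x y => (key _ x.1 x.2 rfl).trans (key _ y.1 y.2 rfl).symm⟩

/-- If `G - v` is connected, then it has a spanning tree rooted at any vertex `r`, given by a
parent function `p` (fixing `r`) and a height function `h`. -/
lemma SimpleGraph.exists_parent_height {V : Type*} (G : SimpleGraph V) {v r : V}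
    (hconn : (G.induce {u | u ≠ v}).Connected) (hr : r ≠ v) :
    ∃ (p : V → V) (h : V → ℕ), p r = r ∧
      ∀ u, u ≠ v → p u ≠ v ∧ (u ≠ r → G.Adj u (p u) ∧ h (p u) < h u) := by
  classical
  set H := G.induce {u | u ≠ v}
  have step : ∀ u : {u | u ≠ v}, u ≠ ⟨r, hr⟩ →
      ∃ w : {u | u ≠ v}, H.Adj u w ∧ H.dist w ⟨r, hr⟩ < H.dist u ⟨r, hr⟩ := by
    intro u hu
    obtain ⟨q, hq⟩ := hconn.exists_walk_length_eq_dist u ⟨r, hr⟩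
    cases q with
    | nil => exact absurd rfl hu
    | cons hadj q' =>
      refine ⟨_, hadj, ?_⟩
      have := dist_le q'
      rw [Walk.length_cons] at hq
      omega
  choose! f hf using step
  refine ⟨fun u => if hu : u ≠ v ∧ u ≠ r then (f ⟨u, hu.1⟩ : V) else u,
    fun u => if hu : u ≠ v then H.dist ⟨u, hu⟩ ⟨r, hr⟩ else 0, by simp, fun u hu => ?_⟩
  by_cases hur : u = r
  · simp [hur, hr]
  · have hf' := hf ⟨u, hu⟩ (by simpa using hur)
    have hfv : (f ⟨u, hu⟩ : V) ≠ v := (f ⟨u, hu⟩).2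
    simp only [hu, hur, ne_eq, not_false_eq_true, and_self, dite_true, hfv, true_and, forall_const]
    exact ⟨hf'.1, hf'.2⟩

/-- A path avoiding `v` that contains `k + 1` neighbours of `v` yields a `k`-fan minor. -/
lemma isMinor_fan_of_path {V : Type*} (G : SimpleGraph V) (k : ℕ) (v : V) (h : V → ℕ)
    (q : ℕ → V) (d : ℕ) (hqv : ∀ i, q i ≠ v)
    (hq : ∀ i < d, G.Adj (q i) (q (i + 1)) ∧ h (q (i + 1)) < h (q i))
    (I : Finset ℕ) (hI : I.card = k + 1) (hId : ∀ i ∈ I, i < d) (hIv : ∀ i ∈ I, G.Adj v (q i)) :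
    IsMinor (fan k) G := by
  have hanti : ∀ i j, i < j → j ≤ d → h (q j) < h (q i) := by
    intro i j hij
    induction j, hij using Nat.le_induction with
    | base => exact fun hj => (hq i hj).2
    | succ j hij ih => exact fun hj => (hq j hj).2.trans (ih (by omega))
  set e := I.orderEmbOfFin hI
  have heI : ∀ j, e j ∈ I := fun j => I.orderEmbOfFin_mem hI j
  have hlt : ∀ j : Fin k, e j.castSucc < e j.succ := fun j => e.strictMono j.castSucc_lt_succ
  have hdisj : ∀ a b : Fin k, a < b →
      Disjoint (q '' Set.Ico (e a.castSucc) (e a.succ))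
        (q '' Set.Ico (e b.castSucc) (e b.succ)) := by
    intro a b hab
    rw [Set.disjoint_left]
    rintro _ ⟨i, hi, rfl⟩ ⟨j, hj, hij⟩
    have h1 : e a.succ ≤ e b.castSucc := e.monotone (Fin.succ_le_castSucc_iff.2 hab)
    have h2 := hId _ (heI b.succ)
    have := hanti i j (hi.2.trans_le (h1.trans hj.1)) (hj.2.le.trans h2.le)
    rw [hij] at this
    exact this.false
  have hspoke : ∀ j : Fin k, ∃ x ∈ q '' Set.Ico (e j.castSucc) (e j.succ), G.Adj v x :=
    fun j => ⟨_, ⟨_, ⟨le_rfl, hlt j⟩, rfl⟩, hIv _ (heI _)⟩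
  have hrim : ∀ a b : Fin k, (a : ℕ) + 1 = b → ∃ x ∈ q '' Set.Ico (e a.castSucc) (e a.succ),
      ∃ y ∈ q '' Set.Ico (e b.castSucc) (e b.succ), G.Adj x y := by
    intro a b hab
    have hab' : a.succ = b.castSucc := Fin.ext (by simpa using hab)
    have h1 := hlt a
    have h2 := hId _ (heI a.succ)
    refine ⟨_, ⟨e a.succ - 1, ⟨by omega, by omega⟩, rfl⟩, _,
      ⟨e b.castSucc, ⟨le_rfl, hlt b⟩, rfl⟩, ?_⟩
    rw [← hab']
    have := (hq (e a.succ - 1) (by omega)).1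
    rwa [Nat.sub_add_cancel (by omega)] at this
  have hv : ∀ j : Fin k, Disjoint {v} (q '' Set.Ico (e j.castSucc) (e j.succ)) := by
    intro j
    rw [Set.disjoint_singleton_left]
    rintro ⟨i, -, hi⟩
    exact hqv i hi
  refine ⟨fun o => o.elim {v} fun j => q '' Set.Ico (e j.castSucc) (e j.succ), ?_, ?_, ?_⟩
  · rintro (_ | j)
    · exact G.induce_connected_of_height h rfl fun x hx hxv => absurd hx hxv
    · have h1 := hlt j
      have h2 := hId _ (heI j.succ)
      refine G.induce_connected_of_height h (r := q (e j.succ - 1))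
        ⟨_, ⟨by omega, by omega⟩, rfl⟩ ?_
      rintro _ ⟨i, hi, rfl⟩ hir
      have hne : i ≠ e j.succ - 1 := fun hi' => hir (by rw [hi'])
      have := hi.1
      have := hi.2
      exact ⟨_, ⟨i + 1, ⟨by omega, by omega⟩, rfl⟩, hq i (by omega)⟩
  · rintro (_ | a) (_ | b) hab
    · exact absurd rfl hab
    · exact hv b
    · exact (hv a).symm
    · rcases lt_trichotomy a b with hlt' | rfl | hlt'
      · exact hdisj a b hlt'
      · exact absurd rfl hab
      · exact (hdisj b a hlt').symm
  · rintro (_ | a) (_ | b) hab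
    · simp [fan] at hab
    · exact ⟨v, rfl, hspoke b⟩
    · obtain ⟨x, hx, hadj⟩ := hspoke a
      exact ⟨x, hx, v, rfl, hadj.symm⟩
    · have hab' : (a : ℕ) + 1 = b ∨ (b : ℕ) + 1 = a := by
        simpa [fan] using (SimpleGraph.fromRel_adj _ _ _).1 hab |>.2
      rcases hab' with hab' | hab'
      · exact hrim a b hab'
      · obtain ⟨x, hx, y, hy, hadj⟩ := hrim b a hab'
        exact ⟨y, hy, x, hx, hadj.symm⟩

/-- Let `k ≥ 2`, `ℓ ≥ 1`, and let `G` be a connected graph with a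
non-cut-vertex `v` of degree at least `2ℓk`.  Then `G` contains the `k`-fan as a minor,
or there are a connected subgraph `X` of `G - v` and a set `S` of `ℓ` neighbours of `v`,
disjoint from `X`, each adjacent to `X`. -/
theorem fan_minor_or_K2l_minor (k l : ℕ) (hk : 2 ≤ k) (hl : 1 ≤ l)
    (V : Type) [Finite V] (G : SimpleGraph V) (hG : G.Connected)
    (v : V) (hcut : (G.induce {u | u ≠ v}).Connected)
    (hdeg : 2 * l * k ≤ (G.neighborSet v).ncard) :
    IsMinor (fan k) G ∨
    ∃ (X : Set V) (S : Set V),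
      (G.induce X).Connected ∧ v ∉ X ∧
      S ⊆ G.neighborSet v ∧ S.ncard = l ∧ Disjoint S X ∧
      ∀ u ∈ S, ∃ x ∈ X, G.Adj u x := by
  classical
  have := Fintype.ofFinite V
  have hlk : 2 * k ≤ 2 * l * k := by nlinarith
  obtain ⟨r, hr⟩ : (G.neighborSet v).Nonempty :=
    Set.nonempty_of_ncard_ne_zero (by omega)
  have hrv : r ≠ v := hr.ne'
  obtain ⟨p, h, hpr, hp⟩ := G.exists_parent_height hcut hrv
  have hiter : ∀ i u, u ≠ v → p^[i] u ≠ v := by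
    intro i
    induction i with
    | zero => exact fun u hu => hu
    | succ i ih => exact fun u hu => ih _ (hp u hu).1
  -- `D` is the union of the tree paths from the neighbours of `v` to the root;
  -- its leaves are its elements that are not parents of elements of `D`.
  set D : Set V := {y | ∃ n, G.Adj v n ∧ ∃ i, p^[i] n = y}
  have hDv : ∀ y ∈ D, y ≠ v := by
    rintro _ ⟨n, hn, i, rfl⟩
    exact hiter i n hn.ne'
  have hrD : r ∈ D := ⟨r, hr, 0, rfl⟩
  have hpD : ∀ y ∈ D, p y ∈ D := by
    rintro _ ⟨n, hn, i, rfl⟩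
    exact ⟨n, hn, i + 1, Function.iterate_succ_apply' p i n⟩
  have hrX : r ∈ p '' D := ⟨r, hrD, hpr⟩
  by_cases hL : l ≤ (D \ p '' D).ncard
  · right
    obtain ⟨S, hS, hSl⟩ := Set.exists_subset_card_eq hL
    refine ⟨p '' D, S, ?_, ?_, ?_, hSl, ?_, ?_⟩
    · refine G.induce_connected_of_height h hrX ?_
      rintro _ ⟨y, hy, rfl⟩ hyr
      exact ⟨_, ⟨_, hpD y hy, rfl⟩, (hp _ (hDv _ (hpD y hy))).2 hyr⟩
    · rintro ⟨y, hy, hyv⟩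
      exact hDv _ (hpD y hy) hyv
    · intro u hu
      obtain ⟨⟨n, hn, i, hi⟩, hu'⟩ := hS hu
      cases i with
      | zero => exact hi ▸ hn
      | succ i =>
        rw [Function.iterate_succ_apply'] at hi
        exact absurd ⟨_, ⟨n, hn, i, rfl⟩, hi⟩ hu'
    · exact Set.disjoint_left.2 fun u hu => (hS hu).2
    · intro u hu
      have hur : u ≠ r := fun hur => (hS hu).2 (hur ▸ hrX)
      exact ⟨p u, ⟨u, (hS hu).1, rfl⟩, ((hp u (hDv u (hS hu).1)).2 hur).1⟩
  · left
    -- every non-root vertex of `D` lies on the tree path from some leaf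
    have hmax : ∀ m, ∀ z ∈ D, z ≠ r → (∑ w, h w) - h z = m →
        ∃ y ∈ D \ p '' D, ∃ i, p^[i] y = z := by
      intro m
      induction m using Nat.strong_induction_on with
      | _ m ih =>
        intro z hz hzr hm
        by_cases hzL : z ∈ p '' D
        · obtain ⟨w, hw, rfl⟩ := hzL
          have hwr : w ≠ r := by
            rintro rfl
            exact hzr hpr
          have hlt := ((hp w (hDv w hw)).2 hwr).2
          have hle : h w ≤ ∑ w, h w :=
            Finset.single_le_sum (fun _ _ => Nat.zero_le _) (Finset.mem_univ w)
          obtain ⟨y, hy, i, hi⟩ := ih _ (by omega) w hw hwr rfl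
          exact ⟨y, hy, i + 1, by rw [Function.iterate_succ_apply', hi]⟩
        · exact ⟨z, ⟨hz, hzL⟩, 0, rfl⟩
    have hroot : ∀ y, ∃ d, y ≠ v → p^[d] y = r ∧ ∀ i < d, p^[i] y ≠ r := by
      intro y
      by_cases hyv : y = v
      · exact ⟨0, fun hne => absurd hyv hne⟩
      · have hex : ∀ m, ∀ y, y ≠ v → h y = m → ∃ d, p^[d] y = r := by
          intro m
          induction m using Nat.strong_induction_on with
          | _ m ih =>
            intro y hy hm
            by_cases hyr : y = r
            · exact ⟨0, hyr⟩
            · obtain ⟨hpy, hlt⟩ := hp y hy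
              obtain ⟨d, hd⟩ := ih _ (hm ▸ (hlt hyr).2) (p y) hpy rfl
              exact ⟨d + 1, hd⟩
        have hex' := hex _ y hyv rfl
        exact ⟨Nat.find hex', fun _ => ⟨Nat.find_spec hex', fun i hi => Nat.find_min hex' hi⟩⟩
    choose d hd using hroot
    let I : V → Finset ℕ := fun y => (Finset.range (d y)).filter fun i => G.Adj v (p^[i] y)
    obtain ⟨y, hyL, hyI⟩ : ∃ y ∈ D \ p '' D, k + 1 ≤ (I y).card := by
      by_contra! hsmall
      have hcover : (G.neighborSet v).toFinset.erase r ⊆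
          (D \ p '' D).toFinset.biUnion fun y => (I y).image fun i => p^[i] y := by
        intro n hn
        rw [Finset.mem_erase, Set.mem_toFinset] at hn
        obtain ⟨hnr, hn⟩ := hn
        obtain ⟨y, hy, i, hi⟩ := hmax _ n ⟨n, hn, 0, rfl⟩ hnr rfl
        simp only [Finset.mem_biUnion, Set.mem_toFinset, Finset.mem_image]
        refine ⟨y, hy, i, ?_, hi⟩
        simp only [I, Finset.mem_filter, Finset.mem_range]
        refine ⟨?_, hi ▸ hn⟩
        by_contra! hdi
        apply hnr
        rw [← hi, ← Nat.sub_add_cancel hdi, Function.iterate_add_apply, (hd y (hDv y hy.1)).1]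
        exact Function.iterate_fixed hpr _
      have hcard := (Finset.card_le_card hcover).trans
        (Finset.card_biUnion_le_card_mul _ _ k fun y hy =>
          Finset.card_image_le.trans (Nat.le_of_lt_succ (hsmall y (Set.mem_toFinset.1 hy))))
      rw [Finset.card_erase_of_mem (Set.mem_toFinset.2 hr), ← Set.ncard_eq_toFinset_card',
        ← Set.ncard_eq_toFinset_card'] at hcard
      have hle : (D \ p '' D).ncard * k ≤ l * k := Nat.mul_le_mul_right k (by omega)
      have hkl : k ≤ l * k := Nat.le_mul_of_pos_left k hl
      have h2 : 2 * l * k = l * k + l * k := by ring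
      omega
    obtain ⟨J, hJ, hJk⟩ := Finset.exists_subset_card_eq hyI
    have hyv := hDv y hyL.1
    refine isMinor_fan_of_path G k v h (fun i => p^[i] y) (d y) (fun i => hiter i y hyv) ?_ J hJk
      (fun i hi => Finset.mem_range.1 (Finset.mem_filter.1 (hJ hi)).1)
      (fun i hi => (Finset.mem_filter.1 (hJ hi)).2)
    intro i hi
    simp only [Function.iterate_succ_apply']
    exact (hp _ (hiter i y hyv)).2 ((hd y hyv).2 i hi)
end

section
/- Let k ≥ 2 be an integer, and let G be a graph with distinct vertices v_1,…,v_k such that C := G − {v_1,…,v_k} is connected and each v_i has at least k³ neighbours in C. Then G contains the k-fan or the k-fat star as a minor. -/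
/-- A set is connected in `G` if from each of its points other than `r` one can step, inside
the set, to a neighbour on which `d` is smaller. -/
theorem induce_connected_of_descent {V : Type*} {G : SimpleGraph V} {S : Set V} {r : V}
    (hr : r ∈ S) (d : V → ℕ)
    (h : ∀ u ∈ S, u ≠ r → ∃ w ∈ S, G.Adj u w ∧ d w < d u) : (G.induce S).Connected := by
  have key : ∀ n, ∀ u (hu : u ∈ S), d u = n → (G.induce S).Reachable ⟨u, hu⟩ ⟨r, hr⟩ := by
    intro n
    induction n using Nat.strong_induction_on with
    | _ n ih =>
      intro u hu hn
      by_cases hur : u = r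
      · subst hur
        exact SimpleGraph.Reachable.refl _
      · obtain ⟨w, hw, hadj, hlt⟩ := h u hu hur
        have hadj' : (G.induce S).Adj ⟨u, hu⟩ ⟨w, hw⟩ := hadj
        exact hadj'.reachable.trans (ih (d w) (hn ▸ hlt) w hw rfl)
  rw [SimpleGraph.connected_iff_exists_forall_reachable]
  exact ⟨⟨r, hr⟩, fun u => (key _ u.1 u.2 rfl).symm⟩

theorem induce_singleton_connected {V : Type*} (G : SimpleGraph V) (x : V) :
    (G.induce {x}).Connected :=
  induce_connected_of_descent (Set.mem_singleton x) (fun _ => 0)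
    fun _ hu hne => absurd hu hne

theorem isMinor_fromRel {α β : Type*} {R : α → α → Prop} {G : SimpleGraph β} (X : α → Set β)
    (hconn : ∀ a, (G.induce (X a)).Connected)
    (hdisj : Pairwise fun a b => Disjoint (X a) (X b))
    (hadj : ∀ a b, R a b → ∃ x ∈ X a, ∃ y ∈ X b, G.Adj x y) :
    IsMinor (SimpleGraph.fromRel R) G := by
  refine ⟨X, hconn, hdisj, fun a b hab => ?_⟩
  rcases hab.2 with h | h
  · exact hadj a b h
  · obtain ⟨x, hx, y, hy, hxy⟩ := hadj b a h
    exact ⟨y, hy, x, hx, hxy.symm⟩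

/-- A vertex with `k` neighbours on a path avoiding it yields a `k`-fan minor. -/
theorem fan_isMinor_of_path {V : Type*} {G : SimpleGraph V} {k L : ℕ} {y : ℕ → V} {d : V → ℕ}
    {z : V} {D : Finset ℕ} (hd : ∀ n ≤ L, d (y n) = n)
    (hadj : ∀ n, n + 1 ≤ L → G.Adj (y (n + 1)) (y n)) (hz : ∀ n ≤ L, z ≠ y n)
    (hDL : ∀ n ∈ D, n ≤ L) (hDz : ∀ n ∈ D, G.Adj z (y n)) (hk : k ≤ D.card) :
    IsMinor (fan k) G := by
  obtain ⟨E, hED, hE⟩ := Finset.exists_subset_card_eq hk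
  let e := E.orderEmbOfFin hE
  have heD : ∀ j, e j ∈ D := fun j => hED (E.orderEmbOfFin_mem hE j)
  let I : Fin k → Set ℕ := fun j => {n | e j ≤ n ∧ n ≤ L ∧ ∀ j', j < j' → n < e j'}
  have heI : ∀ j, e j ∈ I j := fun j =>
    ⟨le_rfl, hDL _ (heD j), fun j' hj => e.strictMono hj⟩
  have hdisj : ∀ i j, i < j → Disjoint (Set.image y (I i)) (Set.image y (I j)) := by
    intro i j hij
    rw [Set.disjoint_left]
    rintro _ ⟨n, hn, rfl⟩ ⟨m, hm, hmn⟩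
    have h1 := hd n hn.2.1
    rw [← hmn, hd m hm.2.1] at h1
    subst h1
    exact absurd (hn.2.2 j hij) (not_lt.2 hm.1)
  have hzI : ∀ j, Disjoint {z} (Set.image y (I j)) := by
    intro j
    rw [Set.disjoint_singleton_left]
    rintro ⟨n, hn, hnz⟩
    exact hz n hn.2.1 hnz.symm
  refine isMinor_fromRel (fun a => a.elim {z} fun j => Set.image y (I j)) ?_ ?_ ?_
  · rintro (_ | j)
    · exact induce_singleton_connected G z
    · refine induce_connected_of_descent (Set.mem_image_of_mem y (heI j)) d ?_
      rintro _ ⟨n, hn, rfl⟩ hne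
      have hlt : e j < n := lt_of_le_of_ne hn.1 fun h => hne (by rw [h])
      obtain ⟨m, rfl⟩ : ∃ m, n = m + 1 := ⟨n - 1, by omega⟩
      have hnL := hn.2.1
      refine ⟨y m, ⟨m, ⟨by omega, by omega, fun j' hj => ?_⟩, rfl⟩, hadj m hnL, ?_⟩
      · have := hn.2.2 j' hj
        omega
      · rw [hd m (by omega), hd _ hnL]
        omega
  · rintro (_ | i) (_ | j) hij
    · exact absurd rfl hij
    · exact hzI j
    · exact (hzI i).symm
    · rcases lt_or_gt_of_ne (fun h => hij (congrArg some h) : i ≠ j) with h | h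
      · exact hdisj i j h
      · exact (hdisj j i h).symm
  · rintro (_ | i) (_ | j) hij
    · exact hij.elim
    · exact ⟨z, rfl, y (e j), ⟨_, heI j, rfl⟩, hDz _ (heD j)⟩
    · exact hij.elim
    · have hij' : (i : ℕ) + 1 = j := hij
      have hlt : e i < e j := e.strictMono (Fin.lt_def.2 (by omega))
      obtain ⟨m, hm⟩ : ∃ m, e j = m + 1 := ⟨e j - 1, by omega⟩
      have hjL := hDL _ (heD j)
      refine ⟨y m, ⟨m, ⟨by omega, by omega, fun j' hj => ?_⟩, rfl⟩, y (e j),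
        ⟨_, heI j, rfl⟩, ?_⟩
      · have : e j ≤ e j' := e.monotone (Fin.le_def.2 (by have := Fin.lt_def.1 hj; omega))
        omega
      · rw [hm]
        exact (hadj m (by omega)).symm

/-- A rainbow antichain: if every set `A w` of predecessors meets each `N a` in at most `m`
points, and all the `N a` are large, then representatives of the `N a` can be chosen, none a
predecessor of another. -/
theorem exists_antichain_representatives {α σ : Type*} [Nonempty α]
    (A : α → Set α) (d : α → ℕ) (m : ℕ) (hm : 0 < m) (hself : ∀ w, w ∈ A w) (s : Finset σ) :
    ∀ N : σ → Finset α,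
      (∀ a, ∀ w ∈ N a, ∀ u ∈ A w, u = w ∨ d u < d w) →
      (∀ a c, ∀ w ∈ N c, ((N a : Set α) ∩ A w).ncard ≤ m) →
      (∀ a, s.card * m ≤ (N a).card) →
      ∃ b : σ → α, (∀ a ∈ s, b a ∈ N a) ∧
        ∀ a ∈ s, ∀ c ∈ s, a ≠ c → b a ∉ A (b c) := by
  classical
  induction hn : s.card generalizing s with
  | zero =>
    intro N _ _ _
    obtain rfl := Finset.card_eq_zero.1 hn
    exact ⟨fun _ => Classical.arbitrary α, by simp, by simp⟩
  | succ n ih =>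
    intro N hd hmN hN
    have hs : s.Nonempty := Finset.card_pos.1 (by omega)
    have hR : (s.biUnion N).Nonempty := by
      obtain ⟨a, ha⟩ := hs
      have : 0 < (N a).card := lt_of_lt_of_le (by positivity) (hN a)
      obtain ⟨x, hx⟩ := Finset.card_pos.1 this
      exact ⟨x, Finset.mem_biUnion.2 ⟨a, ha, hx⟩⟩
    obtain ⟨x, hxR, hmax⟩ := Finset.exists_max_image _ d hR
    obtain ⟨a, ha, hxa⟩ := Finset.mem_biUnion.1 hxR
    obtain ⟨b, hbN, hb⟩ := ih (s.erase a) (by rw [Finset.card_erase_of_mem ha]; omega)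
      (fun c => (N c).filter (· ∉ A x))
      (fun c w hw => hd c w (Finset.mem_filter.1 hw).1)
      (fun c c' w hw => by
        have hfin : ((N c : Set α) ∩ A w).Finite := (N c).finite_toSet.inter_of_left _
        refine (Set.ncard_le_ncard ?_ hfin).trans (hmN c c' w (Finset.mem_filter.1 hw).1)
        exact Set.inter_subset_inter_left _ (Finset.coe_subset.2 (Finset.filter_subset _ _)))
      (fun c => by
        have h1 := Finset.card_filter_add_card_filter_not (s := N c) (· ∈ A x)
        have h2 := hmN c a x hxa
        have h3 : (N c : Set α) ∩ A x = ((N c).filter (· ∈ A x) : Finset α) := by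
          ext; simp
        rw [h3, Set.ncard_coe_finset] at h2
        have h4 := hN c
        rw [add_mul, one_mul] at h4
        omega)
    have hbx : ∀ c ∈ s, c ≠ a → b c ∉ A x ∧ x ∉ A (b c) := by
      intro c hc hca
      have h1 := Finset.mem_filter.1 (hbN c (Finset.mem_erase.2 ⟨hca, hc⟩))
      refine ⟨h1.2, fun hx => ?_⟩
      rcases hd c _ h1.1 x hx with h | h
      · exact h1.2 (h ▸ hself x)
      · exact absurd (hmax _ (Finset.mem_biUnion.2 ⟨c, hc, h1.1⟩)) (not_le.2 h)
    refine ⟨Function.update b a x, fun c hc => ?_, fun c hc c' hc' hcc' => ?_⟩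
    · by_cases hca : c = a
      · subst hca; simpa using hxa
      · rw [Function.update_of_ne hca]
        exact (Finset.mem_filter.1 (hbN c (Finset.mem_erase.2 ⟨hca, hc⟩))).1
    · by_cases hca : c = a
      · subst hca
        rw [Function.update_self, Function.update_of_ne hcc'.symm]
        exact (hbx c' hc' hcc'.symm).2
      · rw [Function.update_of_ne hca]
        by_cases hca' : c' = a
        · subst hca'
          rw [Function.update_self]
          exact (hbx c hc hca).1
        · rw [Function.update_of_ne hca']
          exact hb c (Finset.mem_erase.2 ⟨hca, hc⟩) c' (Finset.mem_erase.2 ⟨hca', hc'⟩) hcc'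

/-- A connected induced subgraph has a breadth-first spanning tree, given by a root `r`, a
parent map `p` and a depth function `d`. -/
theorem exists_parent_of_induce_connected {V : Type*} {G : SimpleGraph V} {C : Set V}
    (hC : (G.induce C).Connected) :
    ∃ r ∈ C, ∃ (p : V → V) (d : V → ℕ), d r = 0 ∧
      ∀ u ∈ C, u ≠ r → p u ∈ C ∧ G.Adj u (p u) ∧ d u = d (p u) + 1 := by
  classical
  obtain ⟨r⟩ := hC.nonempty
  let d : V → ℕ := fun u => if hu : u ∈ C then (G.induce C).dist r ⟨u, hu⟩ else 0
  have hpar : ∀ u : V, ∃ w : V, u ∈ C → u ≠ r → w ∈ C ∧ G.Adj u w ∧ d u = d w + 1 := by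
    intro u
    by_cases h : u ∈ C ∧ u ≠ r
    · obtain ⟨hu, hur⟩ := h
      have hne : (⟨u, hu⟩ : C) ≠ r := fun h => hur (congrArg Subtype.val h)
      obtain ⟨q, hq⟩ := hC.exists_walk_length_eq_dist ⟨u, hu⟩ r
      cases q with
      | nil => exact absurd rfl hne
      | @cons _ w _ hadj q =>
        refine ⟨w, fun _ _ => ⟨w.2, hadj, ?_⟩⟩
        have h1 : (G.induce C).dist w r ≤ q.length := SimpleGraph.dist_le q
        have h2 := hC.dist_triangle (u := ⟨u, hu⟩) (v := w) (w := r)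
        rw [SimpleGraph.dist_eq_one_iff_adj.2 hadj] at h2
        rw [SimpleGraph.Walk.length_cons] at hq
        simp only [d, dif_pos hu, dif_pos w.2]
        rw [SimpleGraph.dist_comm (u := r), SimpleGraph.dist_comm (u := r)]
        change (G.induce C).dist ⟨u, hu⟩ r = (G.induce C).dist w r + 1
        omega
    · exact ⟨u, fun h1 h2 => absurd ⟨h1, h2⟩ h⟩
  choose p hp using hpar
  exact ⟨r, r.2, p, d, by simp [d], hp⟩

/-- Let `k ≥ 2` and let `G` be a graph with distinct vertices
`v 0, …, v (k-1)` such that `C := G - {v 0, …, v (k-1)}` is connected and each `v i` has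
at least `k³` neighbours in `C`.  Then `G` contains the `k`-fan or the `k`-fat star as a
minor. -/
theorem fan_or_fatStar_of_many_high_degree (k : ℕ) (hk : 2 ≤ k)
    (V : Type) [Finite V] (G : SimpleGraph V)
    (v : Fin k → V) (hv : Function.Injective v)
    (hC : (G.induce {u | ∀ i, u ≠ v i}).Connected)
    (hdeg : ∀ i, k ^ 3 ≤ {u | (∀ j, u ≠ v j) ∧ G.Adj (v i) u}.ncard) :
    IsMinor (fan k) G ∨ IsMinor (fatStar k) G := by
  classical
  refine or_iff_not_imp_left.2 fun hfan => ?_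
  obtain ⟨r, hr, p, d, hdr, hp⟩ := exists_parent_of_induce_connected hC
  set C : Set V := {u | ∀ i, u ≠ v i} with hCdef
  let A : V → Set V := fun w => {u | ∃ n ≤ d w, p^[n] w = u}
  have hiter : ∀ n, ∀ w ∈ C, n ≤ d w → p^[n] w ∈ C ∧ d (p^[n] w) + n = d w := by
    intro n
    induction n with
    | zero => intro w hw _; exact ⟨hw, rfl⟩
    | succ n ih =>
      intro w hw hn
      obtain ⟨h1, h2⟩ := ih w hw (by omega)
      have h3 := hp _ h1 (fun h => by rw [h, hdr] at h2; omega)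
      rw [Function.iterate_succ_apply']
      exact ⟨h3.1, by omega⟩
  have hroot : ∀ u ∈ C, d u = 0 → u = r := by
    intro u hu h0
    by_contra hne
    have := (hp u hu hne).2.2
    omega
  have hself : ∀ w, w ∈ A w := fun w => ⟨0, Nat.zero_le _, rfl⟩
  have hAd : ∀ w ∈ C, ∀ u ∈ A w, u = w ∨ d u < d w := by
    rintro w hw _ ⟨n, hn, rfl⟩
    have := (hiter n w hw hn).2
    rcases Nat.eq_zero_or_pos n with rfl | h
    · exact Or.inl rfl
    · right; omega
  have hAroot : ∀ w ∈ C, r ∈ A w := by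
    intro w hw
    obtain ⟨h1, h2⟩ := hiter (d w) w hw le_rfl
    exact ⟨d w, le_rfl, hroot _ h1 (by omega)⟩
  have hAp : ∀ w ∈ C, w ≠ r → A (p w) ⊆ A w := by
    rintro w hw hwr _ ⟨n, hn, rfl⟩
    have := (hp w hw hwr).2.2
    exact ⟨n + 1, by omega, rfl⟩
  let N : Fin k → Finset V := fun i => {u | (∀ j, u ≠ v j) ∧ G.Adj (v i) u}.toFinite.toFinset
  have hN : ∀ i u, u ∈ N i ↔ u ∈ C ∧ G.Adj (v i) u := fun i u => by
    simp [N, hCdef]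
  have hNA : ∀ i, ∀ w ∈ C, ((N i : Set V) ∩ A w).ncard ≤ k - 1 := by
    intro i w hw
    by_contra hlt
    have hyd : ∀ n ≤ d w, p^[d w - n] w ∈ C ∧ d (p^[d w - n] w) = n := fun n hn => by
      obtain ⟨h1, h2⟩ := hiter (d w - n) w hw (by omega)
      exact ⟨h1, by omega⟩
    let D : Finset ℕ := (Finset.range (d w + 1)).filter fun n => p^[d w - n] w ∈ N i
    have hDimg : (N i : Set V) ∩ A w ⊆ (D.image fun n => p^[d w - n] w : Finset V) := by
      rintro _ ⟨hu, n, hn, rfl⟩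
      have h : d w - (d w - n) = n := by omega
      refine Finset.mem_coe.2 (Finset.mem_image.2 ⟨d w - n, Finset.mem_filter.2 ⟨?_, ?_⟩, ?_⟩)
      · exact Finset.mem_range.2 (by omega)
      · rw [h]; exact hu
      · simp only [h]
    have hcard : k ≤ D.card := by
      have h1 := Set.ncard_le_ncard hDimg (Finset.finite_toSet _)
      rw [Set.ncard_coe_finset] at h1
      have h2 := Finset.card_image_le (s := D) (f := fun n => p^[d w - n] w)
      omega
    refine hfan (fan_isMinor_of_path (y := fun n => p^[d w - n] w) (z := v i)
      (fun n hn => (hyd n hn).2) (fun n hn => ?_) (fun n hn => ?_) (fun n hn => ?_)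
      (fun n hn => ?_) hcard)
    · obtain ⟨h1, h2⟩ := hyd (n + 1) hn
      have h3 := (hp _ h1 (fun h => by rw [h, hdr] at h2; omega)).2.1
      rw [← Function.iterate_succ_apply' p] at h3
      have h4 : (d w - (n + 1)).succ = d w - n := by omega
      rwa [h4] at h3
    · exact ((hyd n hn).1 i).symm
    · have := Finset.mem_range.1 (Finset.mem_filter.1 hn).1
      omega
    · exact ((hN i _).1 (Finset.mem_filter.1 hn).2).2
  have : Nonempty V := ⟨r⟩
  obtain ⟨b, hbN, hb⟩ := exists_antichain_representatives A d (k - 1) (by omega) hself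
    (Finset.univ : Finset (Fin k × Option (Fin k))) (fun a => N a.1)
    (fun a w hw => hAd w ((hN _ _).1 hw).1)
    (fun a c w hw => hNA a.1 w ((hN _ _).1 hw).1)
    (fun a => by
      have h1 := hdeg a.1
      rw [Set.ncard_eq_toFinset_card _ (Set.toFinite _)] at h1
      refine le_trans ?_ h1
      obtain ⟨m, rfl⟩ : ∃ m, k = m + 1 := ⟨k - 1, by omega⟩
      simp only [Finset.card_univ, Fintype.card_prod, Fintype.card_fin, Fintype.card_option,
        Nat.add_sub_cancel]
      nlinarith)
  have hbC : ∀ a, b a ∈ C := fun a => ((hN _ _).1 (hbN a (Finset.mem_univ a))).1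
  have hbadj : ∀ a, G.Adj (v a.1) (b a) := fun a => ((hN _ _).1 (hbN a (Finset.mem_univ a))).2
  have hb' : ∀ a c, b a ∈ A (b c) → a = c := fun a c h => by
    by_contra hne
    exact hb a (Finset.mem_univ a) c (Finset.mem_univ c) hne h
  have hbinj : ∀ a c, b a = b c → a = c := fun a c h => hb' a c (h ▸ hself _)
  have hbr : ∀ a, b a ≠ r := by
    rintro ⟨i, j⟩ h
    have h0 : ∀ c, (i, j) = c := fun c => hb' _ c (h ▸ hAroot _ (hbC c))
    have h1 := (h0 (i, none)).symm.trans (h0 (i, some i))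
    simp at h1
  let S : Set V := {u | u ∈ C ∧ ∀ a, b a ∉ A u}
  have hrS : r ∈ S := by
    refine ⟨hr, fun a h => ?_⟩
    rcases hAd r hr _ h with h | h
    · exact hbr a h
    · omega
  have hpb : ∀ a, p (b a) ∈ S ∧ G.Adj (p (b a)) (b a) := by
    intro a
    obtain ⟨h1, h2, h3⟩ := hp _ (hbC a) (hbr a)
    refine ⟨⟨h1, fun c hc => ?_⟩, h2.symm⟩
    obtain rfl := hb' c a (hAp _ (hbC a) (hbr a) hc)
    rcases hAd _ h1 _ hc with h | h
    · exact h2.ne h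
    · omega
  have hbS : ∀ a, b a ∉ S := fun a h => h.2 a (hself _)
  have hvS : ∀ i, v i ∉ S := fun i h => h.1 i rfl
  have hvb : ∀ i a, v i ≠ b a := fun i a h => hbC a i h.symm
  refine isMinor_fromRel (fun a => match a with
    | Sum.inl _ => S
    | Sum.inr (Sum.inl i) => {v i, b (i, none)}
    | Sum.inr (Sum.inr (i, j)) => {b (i, some j)}) ?_ ?_ ?_
  · rintro (_ | i | ⟨i, j⟩)
    · refine induce_connected_of_descent hrS d fun u hu hur => ?_
      obtain ⟨h1, h2, h3⟩ := hp u hu.1 hur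
      exact ⟨p u, ⟨h1, fun a ha => hu.2 a (hAp u hu.1 hur ha)⟩, h2, by omega⟩
    · exact SimpleGraph.induce_pair_connected_of_adj (hbadj (i, none))
    · exact induce_singleton_connected G _
  · rintro (_ | i | ⟨i, j⟩) (_ | i' | ⟨i', j'⟩) hne <;>
      simp only [Set.disjoint_left, Set.mem_insert_iff, Set.mem_singleton_iff, ne_eq,
        Sum.inr.injEq, Sum.inl.injEq, Prod.mk.injEq] at hne ⊢ <;> intro u hu hu'
    all_goals grind
  · rintro (_ | i | ⟨i, j⟩) (_ | i' | ⟨i', j'⟩) h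
    · exact h.elim
    · exact ⟨_, (hpb (i', none)).1, _, Or.inr rfl, (hpb (i', none)).2⟩
    · exact ⟨_, (hpb (i', some j')).1, _, rfl, (hpb (i', some j')).2⟩
    · exact h.elim
    · exact h.elim
    · obtain rfl : i = i' := h
      exact ⟨_, Or.inl rfl, _, rfl, hbadj (i, some j')⟩
    all_goals exact h.elim
end

section
/- Let k ≥ 2 be an integer, let G be a connected graph, and let V_0, V_1, … be the BFS layering of G starting at some vertex r. If for some integers i ≥ 0 and c ≥ 0 the subgraph of G induced by V_i ∪ V_{i+1} ∪ … ∪ V_{i+c} contains a path on at least k^{c+1} vertices, then G contains the k-fan as a minor. -/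
/-- In a connected graph, every vertex at distance `n + 1` from `r` has a neighbour at
distance `n` from `r`. -/
theorem exists_adj_dist_eq {V : Type*} {G : SimpleGraph V} (hG : G.Connected) {r u : V} {n : ℕ}
    (h : G.dist r u = n + 1) : ∃ w, G.Adj w u ∧ G.dist r w = n := by
  obtain ⟨p, hp⟩ := hG.exists_walk_length_eq_dist u r
  rw [SimpleGraph.dist_comm, h] at hp
  cases p with
  | nil => simp at hp
  | @cons _ w _ huw q =>
    refine ⟨w, huw.symm, ?_⟩
    have hq : G.dist w r ≤ q.length := SimpleGraph.dist_le q
    have htri : G.dist r u ≤ G.dist r w + G.dist w u := hG.dist_triangle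
    rw [SimpleGraph.dist_eq_one_iff_adj.mpr huw.symm] at htri
    rw [SimpleGraph.dist_comm] at hq
    simp only [SimpleGraph.Walk.length_cons] at hp
    omega

/-- A ball around `r` induces a connected subgraph. -/
theorem connected_induce_dist_lt {V : Type*} {G : SimpleGraph V} (hG : G.Connected) (r : V)
    {i : ℕ} (hi : 0 < i) : (G.induce {u | G.dist r u < i}).Connected := by
  rw [SimpleGraph.connected_iff_exists_forall_reachable]
  refine ⟨⟨r, by simpa using hi⟩, ?_⟩
  suffices h : ∀ n, ∀ u (hu : G.dist r u < i), G.dist r u = n →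
      (G.induce {u | G.dist r u < i}).Reachable ⟨r, by simpa using hi⟩ ⟨u, hu⟩ from
    fun ⟨u, hu⟩ => h _ u hu rfl
  intro n
  induction n with
  | zero =>
    intro u hu h
    obtain rfl := hG.dist_eq_zero_iff.mp h
    exact SimpleGraph.Reachable.refl _
  | succ n ih =>
    intro u hu h
    obtain ⟨w, hwu, hw⟩ := exists_adj_dist_eq hG h
    have hwi : G.dist r w < i := by omega
    refine (ih w hwi hw).trans (SimpleGraph.Adj.reachable ?_)
    simpa using hwu

/-- The vertices of a nonempty contiguous piece of a path induce a connected subgraph. -/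
theorem connected_induce_image_Ico {V : Type*} {G : SimpleGraph V} {f : ℕ → V} {a b : ℕ}
    (hab : a < b) (hf : ∀ j, a ≤ j → j + 1 < b → G.Adj (f j) (f (j + 1))) :
    (G.induce (f '' Set.Ico a b)).Connected := by
  rw [SimpleGraph.connected_iff_exists_forall_reachable]
  refine ⟨⟨f a, a, ⟨le_rfl, hab⟩, rfl⟩, ?_⟩
  rintro ⟨_, j, ⟨haj, hjb⟩, rfl⟩
  induction j, haj using Nat.le_induction with
  | base => exact SimpleGraph.Reachable.refl _
  | succ j haj ih =>
    refine (ih (by omega)).trans (SimpleGraph.Adj.reachable ?_)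
    simpa using hf j haj hjb

/-- If a path splits into `k` consecutive pieces of length `n`, each of which meets the `i`-th
BFS layer and avoids the earlier layers, then contracting these pieces and the union of the
earlier layers gives a `k`-fan. -/
theorem fan_minor_of_blocks_meet_layer {V : Type*} {G : SimpleGraph V} (hG : G.Connected) {r : V}
    {k : ℕ} (hk : 2 ≤ k) {f : ℕ → V} {a n i : ℕ}
    (hinj : Set.InjOn f (Set.Ico a (a + k * n)))
    (hadj : ∀ j, a ≤ j → j + 1 < a + k * n → G.Adj (f j) (f (j + 1)))
    (hlow : ∀ j ∈ Set.Ico a (a + k * n), i ≤ G.dist r (f j))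
    (hmeet : ∀ b < k, ∃ j ∈ Set.Ico (a + b * n) (a + (b + 1) * n), G.dist r (f j) = i) :
    IsMinor (fan k) G := by
  have hle {b : ℕ} (hb : b < k) : a + (b + 1) * n ≤ a + k * n :=
    Nat.add_le_add_left (Nat.mul_le_mul_right n hb) a
  have hsub {b j : ℕ} (hb : b < k) (hj : j ∈ Set.Ico (a + b * n) (a + (b + 1) * n)) :
      j ∈ Set.Ico a (a + k * n) :=
    ⟨(Nat.le_add_right _ _).trans hj.1, hj.2.trans_le (hle hb)⟩
  have hn : 0 < n := by
    obtain ⟨j, hj, -⟩ := hmeet 0 (by omega)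
    simp only [Set.mem_Ico] at hj
    omega
  have hdisj {b b' j j' : ℕ} (hbb : b < b') (hj : j ∈ Set.Ico (a + b * n) (a + (b + 1) * n))
      (hj' : j' ∈ Set.Ico (a + b' * n) (a + (b' + 1) * n)) : j < j' :=
    hj.2.trans_le ((Nat.add_le_add_left (Nat.mul_le_mul_right n hbb) a).trans hj'.1)
  have hi : 0 < i := by
    rw [Nat.pos_iff_ne_zero]
    rintro rfl
    obtain ⟨j, hj, hjr⟩ := hmeet 0 (by omega)
    obtain ⟨j', hj', hjr'⟩ := hmeet 1 (by omega)
    rw [hG.dist_eq_zero_iff] at hjr hjr'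
    exact (hdisj zero_lt_one hj hj').ne
      (hinj (hsub (by omega) hj) (hsub (by omega) hj') (hjr.symm.trans hjr'))
  let X : Option (Fin k) → Set V := fun o => o.elim {u | G.dist r u < i}
    fun b => f '' Set.Ico (a + b * n) (a + (b + 1) * n)
  have hball (b : Fin k) : Disjoint (X none) (X (some b)) := by
    rw [Set.disjoint_left]
    rintro _ hu ⟨j, hj, rfl⟩
    exact (hlow j (hsub b.2 hj)).not_gt hu
  have hpieces {b b' : Fin k} (hbb : b < b') : Disjoint (X (some b)) (X (some b')) := by
    rw [Set.disjoint_left]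
    rintro _ ⟨j, hj, rfl⟩ ⟨j', hj', h⟩
    exact (hdisj hbb hj hj').ne' (hinj (hsub b'.2 hj') (hsub b.2 hj) h)
  have hdom (b : Fin k) : ∃ x ∈ X none, ∃ y ∈ X (some b), G.Adj x y := by
    obtain ⟨j, hj, hji⟩ := hmeet b b.2
    obtain ⟨w, hw, hwi⟩ := exists_adj_dist_eq hG (n := i - 1) (hji.trans (by omega))
    exact ⟨w, show G.dist r w < i by omega, f j, ⟨j, hj, rfl⟩, hw⟩
  have hnext {b b' : Fin k} (hbb : (b : ℕ) + 1 = b') :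
      ∃ x ∈ X (some b), ∃ y ∈ X (some b'), G.Adj x y := by
    have hb := hle b'.2
    have hexp : a + ((b : ℕ) + 1) * n = a + b * n + n := by ring
    have hexp' : a + ((b' : ℕ) + 1) * n = a + ((b : ℕ) + 1) * n + n := by rw [← hbb]; ring
    refine ⟨_, ⟨a + (b + 1) * n - 1, ⟨by omega, by omega⟩, rfl⟩, _,
      ⟨a + (b + 1) * n - 1 + 1, ⟨by rw [← hbb]; omega, by omega⟩, rfl⟩, ?_⟩
    exact hadj _ (by omega) (by omega)
  have hswap {o o' : Option (Fin k)} (h : ∃ x ∈ X o, ∃ y ∈ X o', G.Adj x y) :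
      ∃ x ∈ X o', ∃ y ∈ X o, G.Adj x y := by
    obtain ⟨x, hx, y, hy, hxy⟩ := h
    exact ⟨y, hy, x, hx, hxy.symm⟩
  refine ⟨X, ?_, ?_, ?_⟩
  · rintro (_ | b)
    · exact connected_induce_dist_lt hG r hi
    · refine connected_induce_image_Ico ?_ fun j hj hj' =>
        hadj j ((Nat.le_add_right _ _).trans hj) (hj'.trans_le (hle b.2))
      have hexp : a + ((b : ℕ) + 1) * n = a + b * n + n := by ring
      omega
  · rintro (_ | b) (_ | b') hne
    · exact absurd rfl hne
    · exact hball b'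
    · exact (hball b).symm
    · rcases lt_trichotomy b b' with h | rfl | h
      · exact hpieces h
      · exact absurd rfl hne
      · exact (hpieces h).symm
  · rintro (_ | b) (_ | b') h <;> simp only [fan, SimpleGraph.fromRel_adj] at h
    · exact absurd rfl h.1
    · exact hdom b'
    · exact hswap (hdom b)
    · rcases h.2 with h | h
      · exact hnext h
      · exact hswap (hnext h)

/-- A path on `k ^ d` vertices within `d` consecutive BFS layers forces a `k`-fan minor. -/
theorem fan_minor_of_path_in_layers {V : Type*} {G : SimpleGraph V} (hG : G.Connected) {r : V}
    {k : ℕ} (hk : 2 ≤ k) {f : ℕ → V} (d : ℕ) : ∀ (a i : ℕ),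
    Set.InjOn f (Set.Ico a (a + k ^ d)) →
    (∀ j, a ≤ j → j + 1 < a + k ^ d → G.Adj (f j) (f (j + 1))) →
    (∀ j ∈ Set.Ico a (a + k ^ d), i ≤ G.dist r (f j) ∧ G.dist r (f j) < i + d) →
    IsMinor (fan k) G := by
  induction d with
  | zero =>
    intro a i _ _ hdist
    have := hdist a (by simp)
    omega
  | succ d ih =>
    intro a i hinj hadj hdist
    rw [pow_succ'] at hinj hadj hdist
    by_cases hmeet : ∀ b < k, ∃ j ∈ Set.Ico (a + b * k ^ d) (a + (b + 1) * k ^ d),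
        G.dist r (f j) = i
    · exact fan_minor_of_blocks_meet_layer hG hk hinj hadj (fun j hj => (hdist j hj).1) hmeet
    · push Not at hmeet
      obtain ⟨b, hb, hmiss⟩ := hmeet
      have hle : (b + 1) * k ^ d ≤ k * k ^ d := Nat.mul_le_mul_right _ hb
      have hexp : (b + 1) * k ^ d = b * k ^ d + k ^ d := by ring
      have hsub : Set.Ico (a + b * k ^ d) (a + b * k ^ d + k ^ d) ⊆
          Set.Ico a (a + k * k ^ d) := Set.Ico_subset_Ico (by omega) (by omega)
      refine ih (a + b * k ^ d) (i + 1) (hinj.mono hsub)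
        (fun j hj hj' => hadj j (by omega) (by omega)) fun j hj => ?_
      have hj' := hdist j (hsub hj)
      have hne := hmiss j ⟨hj.1, hj.2.trans_le (by omega)⟩
      omega

/-- Let `k ≥ 2`, let `G` be a connected graph with BFS layering
`V_j = {u | dist r u = j}` from a vertex `r`.  If the subgraph induced by
`V_i ∪ … ∪ V_{i+c}` contains a path on at least `k^{c+1}` vertices, then `G` contains the
`k`-fan as a minor. -/
theorem fan_minor_of_long_path_in_layers (k : ℕ) (hk : 2 ≤ k)
    (V : Type) [Finite V] (G : SimpleGraph V) (hG : G.Connected)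
    (r : V) (i c m : ℕ) (hm : k ^ (c + 1) ≤ m)
    (hpath : IsSubgraphEmb (SimpleGraph.pathGraph m)
      (G.induce {u | i ≤ G.dist r u ∧ G.dist r u ≤ i + c})) :
    IsMinor (fan k) G := by
  obtain ⟨f, hf, hadj⟩ := hpath
  have hpos : 0 < m := (pow_pos (by omega) _).trans_le hm
  let g : ℕ → V := fun j => f ⟨min j (m - 1), by omega⟩
  have hg {j : ℕ} (hj : j < m) : g j = f ⟨j, hj⟩ := by
    have hmin : min j (m - 1) = j := by omega
    simp only [g, hmin]
  refine fan_minor_of_path_in_layers (r := r) (f := g) hG hk (c + 1) 0 i ?_ ?_ ?_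
  · intro j hj j' hj' h
    simp only [Set.mem_Ico] at hj hj'
    rw [hg (by omega : j < m), hg (by omega : j' < m)] at h
    exact congrArg Fin.val (hf (Subtype.ext h))
  · intro j _ hj
    rw [hg (by omega : j < m), hg (by omega : j + 1 < m)]
    have h := hadj ⟨j, by omega⟩ ⟨j + 1, by omega⟩
      (SimpleGraph.pathGraph_adj.mpr (Or.inl rfl))
    simpa using h
  · intro j hj
    simp only [Set.mem_Ico] at hj
    rw [hg (by omega : j < m)]
    have h : i ≤ G.dist r (f ⟨j, by omega⟩) ∧ G.dist r (f ⟨j, by omega⟩) ≤ i + c :=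
      (f ⟨j, by omega⟩).2
    omega
end
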